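/- arXiv:2309.13138 — 14 statements merged into one kernel-verified Lean document; each statement's English description precedes it below -/
import Mathlib

section
/- Let G be a finite connected simple graph of order at least 3 with at most two blocks. If G has diameter 2 and contains no induced cycle of length 5, then G is 2-bootstrap good. -/
open SimpleGraph

variable {V : Type*}

/-- One round of `r`-bootstrap percolation: a vertex becomes infected if it has
at least `r` infected neighbors. -/
def percStep (G : SimpleGraph V) (r : ℕ) (A : Set V) : Set V :=
  A ∪ {v | r ≤ (G.neighborSet v ∩ A).ncard}

/-- The infected set `A_t` after `t` rounds of spreading from `A₀ = A`. -/
def percIter (G : SimpleGraph V) (r : ℕ) (A : Set V) : ℕ → Set V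
  | 0 => A
  | t + 1 => percStep G r (percIter G r A t)

/-- `A` percolates: eventually every vertex is infected. -/
def Percolates (G : SimpleGraph V) (r : ℕ) (A : Set V) : Prop :=
  ∃ t, percIter G r A t = Set.univ

/-- `A` percolates in exactly `k` rounds, counting the initial round as round 1:
`k` is the least positive integer with `A_{k-1} = V(G)`. -/
def PercolatesIn (G : SimpleGraph V) (r : ℕ) (A : Set V) (k : ℕ) : Prop :=
  0 < k ∧ percIter G r A (k - 1) = Set.univ ∧ ∀ j < k - 1, percIter G r A j ≠ Set.univ

/-- `G` is `r`-bootstrap good: some set of exactly `r` vertices percolates. -/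
def BootstrapGood (G : SimpleGraph V) (r : ℕ) : Prop :=
  ∃ A : Set V, A.ncard = r ∧ Percolates G r A

/-- `B` induces a connected subgraph of `G` having no cut vertex of its own:
removing any vertex of `B` leaves all remaining pairs reachable. -/
def BlockPred (G : SimpleGraph V) (B : Set V) : Prop :=
  (G.induce B).Connected ∧
    ∀ v ∈ B, ∀ a b : ↥(B \ {v}), (G.induce (B \ {v})).Reachable a b

/-- A block of `G`: a maximal connected induced subgraph without a cut vertex. -/
def IsBlock (G : SimpleGraph V) (B : Set V) : Prop :=
  BlockPred G B ∧ ∀ B' : Set V, B ⊆ B' → BlockPred G B' → B' = B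

/-- Vertices infected from the pair `a`, `b` at threshold two. -/
inductive Infd (G : SimpleGraph V) (a b : V) : V → Prop
  | left : Infd G a b a
  | right : Infd G a b b
  | step (x y v : V) (hxy : x ≠ y) (hx : G.Adj v x) (hy : G.Adj v y)
      (ix : Infd G a b x) (iy : Infd G a b y) : Infd G a b v

theorem percIter_mono' (G : SimpleGraph V) (A : Set V) : Monotone (percIter G 2 A) :=
  monotone_nat_of_le_succ fun _ => Set.subset_union_left

theorem Infd.exists_iter [Finite V] {G : SimpleGraph V} {a b v : V} (h : Infd G a b v) :
    ∃ t, v ∈ percIter G 2 {a, b} t := by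
  induction h with
  | left => exact ⟨0, by simp [percIter]⟩
  | right => exact ⟨0, by simp [percIter]⟩
  | step x y v hxy hx hy _ _ ihx ihy =>
    obtain ⟨t, ht⟩ := ihx
    obtain ⟨u, hu⟩ := ihy
    refine ⟨max t u + 1, Or.inr ?_⟩
    have h1 := percIter_mono' G {a, b} (le_max_left t u) ht
    have h2 := percIter_mono' G {a, b} (le_max_right t u) hu
    have : ({x, y} : Set V) ⊆ G.neighborSet v ∩ percIter G 2 {a, b} (max t u) := by
      intro z hz
      rcases hz with rfl | rfl
      · exact ⟨hx, h1⟩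
      · exact ⟨hy, h2⟩
    have h3 := Set.ncard_le_ncard this (Set.toFinite _)
    rw [Set.ncard_pair hxy] at h3
    exact h3

theorem good_of_infd [Finite V] {G : SimpleGraph V} {a b : V} (hab : a ≠ b)
    (h : ∀ v, Infd G a b v) : BootstrapGood G 2 := by
  cases nonempty_fintype V
  refine ⟨{a, b}, Set.ncard_pair hab, ?_⟩
  choose f hf using fun v => (h v).exists_iter
  refine ⟨Finset.univ.sup f, Set.eq_univ_of_forall fun v => ?_⟩
  exact percIter_mono' G {a, b} (Finset.le_sup (Finset.mem_univ v)) (hf v)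

theorem no_c5 {G : SimpleGraph V} (hC5 : IsEmpty (cycleGraph 5 ↪g G)) (p0 p1 p2 p3 p4 : V)
    (h01 : G.Adj p0 p1) (h12 : G.Adj p1 p2) (h23 : G.Adj p2 p3) (h34 : G.Adj p3 p4)
    (h40 : G.Adj p4 p0) (h02 : ¬ G.Adj p0 p2) (h13 : ¬ G.Adj p1 p3) (h24 : ¬ G.Adj p2 p4)
    (h30 : ¬ G.Adj p3 p0) (h41 : ¬ G.Adj p4 p1) : False := by
  have e1 := h01.symm
  have e2 := h12.symm
  have e3 := h23.symm
  have e4 := h34.symm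
  have e5 := h40.symm
  have n1 : ¬ G.Adj p2 p0 := fun h => h02 h.symm
  have n2 : ¬ G.Adj p3 p1 := fun h => h13 h.symm
  have n3 : ¬ G.Adj p4 p2 := fun h => h24 h.symm
  have n4 : ¬ G.Adj p0 p3 := fun h => h30 h.symm
  have n5 : ¬ G.Adj p1 p4 := fun h => h41 h.symm
  have key : ∀ i j : Fin 5, G.Adj (![p0, p1, p2, p3, p4] i) (![p0, p1, p2, p3, p4] j) ↔
      (cycleGraph 5).Adj i j := by
    intro i j
    fin_cases i <;> fin_cases j <;> simp [cycleGraph_adj, *] <;> decide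
  have sep : ∀ i j : Fin 5, (∀ k, (cycleGraph 5).Adj i k ↔ (cycleGraph 5).Adj j k) → i = j := by
    simp only [cycleGraph_adj]
    decide
  refine hC5.false ⟨⟨![p0, p1, p2, p3, p4], ?_⟩, ?_⟩
  · intro i j hij
    refine sep i j fun k => ?_
    rw [← key, ← key, hij]
  · intro i j
    exact key i j

theorem exists_mid {V : Type*} [Finite V] {G : SimpleGraph V} (hconn : G.Connected)
    (hdiam : G.diam = 2) (u v : V) (huv : u ≠ v) (h : ¬ G.Adj u v) :
    ∃ w, G.Adj u w ∧ G.Adj w v := by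
  have h1 : G.dist u v ≤ 2 := by
    rw [← hdiam]
    apply dist_le_diam
    intro h
    simp [diam, h] at hdiam
  obtain ⟨p, hp⟩ := hconn.exists_walk_length_eq_dist u v
  match p, hp with
  | .nil, _ => exact absurd rfl huv
  | .cons e .nil, _ => exact absurd e h
  | .cons e (.cons f .nil), _ => exact ⟨_, e, f⟩
  | .cons e (.cons f (.cons g q)), hp =>
    simp at hp
    omega

theorem blockPred_pair {G : SimpleGraph V} {s a : V} (h : G.Adj s a) :
    BlockPred G {s, a} := by
  refine ⟨induce_pair_connected_of_adj h, ?_⟩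
  rintro v hv ⟨x, hx⟩ ⟨y, hy⟩
  have : x = y := by
    simp only [Set.mem_diff, Set.mem_insert_iff, Set.mem_singleton_iff] at hx hy hv
    grind
  subst this
  rfl

theorem exists_block [Finite V] {G : SimpleGraph V} {s a : V} (h : G.Adj s a) :
    ∃ B, IsBlock G B ∧ s ∈ B ∧ a ∈ B := by
  obtain ⟨B, hB, hm⟩ := (Set.toFinite {B : Set V | BlockPred G B}).exists_le_maximal
    (blockPred_pair h)
  refine ⟨B, ⟨hm.1, fun B' hBB hB' => ?_⟩, hB (by simp), hB (by simp)⟩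
  exact Set.Subset.antisymm (hm.2 hB' hBB) hBB

/-- A block through `s` does not meet both sides of a separation at `s`. -/
theorem block_sep {G : SimpleGraph V} {B P : Set V} {s a c : V} (hB : BlockPred G B)
    (hs : s ∈ B) (ha : a ∈ B) (hc : c ∈ B) (has : a ≠ s) (hcs : c ≠ s)
    (haP : a ∈ P) (hcP : c ∉ P)
    (hsep : ∀ x ∈ P, ∀ y ∉ P, x ≠ s → y ≠ s → ¬ G.Adj x y) : False := by
  obtain ⟨p⟩ := hB.2 s hs ⟨a, ha, has⟩ ⟨c, hc, hcs⟩
  have : ∀ (u v : ↥(B \ {s})), (G.induce (B \ {s})).Walk u v → u.1 ∈ P → v.1 ∈ P := by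
    intro u v p
    induction p with
    | nil => exact id
    | @cons u v w e _ ih =>
      intro hu
      apply ih
      by_contra hv
      exact hsep u.1 hu v.1 hv u.2.2 v.2.2 e
  exact hcP (this _ _ p haP)

/-- A finite connected graph of order at least 3 with at most two blocks, diameter 2,
and no induced 5-cycle is 2-bootstrap good. -/
theorem stmt_1 {V : Type*} [Fintype V] (G : SimpleGraph V)
    (hconn : G.Connected) (hcard : 3 ≤ Fintype.card V)
    (hblocks : {B : Set V | IsBlock G B}.ncard ≤ 2)
    (hdiam : G.diam = 2)
    (hC5 : IsEmpty (cycleGraph 5 ↪g G)) :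
    BootstrapGood G 2 := by
  classical
  have hmid := exists_mid hconn hdiam
  have : Nontrivial V := Fintype.one_lt_card_iff_nontrivial.mp (by omega)
  -- a pair with the largest closure
  obtain ⟨a0, b0, hab0⟩ := exists_pair_ne V
  obtain ⟨⟨a, b⟩, hab, hmax⟩ := (Set.toFinite {p : V × V | p.1 ≠ p.2}).exists_maximalFor
    (fun p => {v | Infd G p.1 p.2 v}) _ ⟨(a0, b0), hab0⟩
  simp only [Set.mem_setOf_eq] at hab hmax
  have hmax' : ∀ c d, c ≠ d → (∀ v, Infd G a b v → Infd G c d v) →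
      ∀ v, Infd G c d v → Infd G a b v := fun c d hcd h => hmax (j := (c, d)) hcd h
  by_cases hall : ∀ v, Infd G a b v
  · exact good_of_infd hab hall
  push Not at hall
  obtain ⟨z, hz⟩ := hall
  have uniq : ∀ x, ¬ Infd G a b x → ∀ s t, Infd G a b s → Infd G a b t → G.Adj x s →
      G.Adj x t → s = t := by
    intro x hx s t hs ht hxs hxt
    by_contra hst
    exact hx (.step s t x hst hxs hxt hs ht)
  -- no induced path of length two from an attached vertex inside the closure
  have nop : ∀ s x, Infd G a b s → ¬ Infd G a b x → G.Adj x s → ∀ c t, Infd G a b c →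
      Infd G a b t → G.Adj s c → G.Adj c t → t = s ∨ G.Adj s t := by
    intro s x hs hx hxs c t hc ht hsc hct
    by_contra hcon
    push Not at hcon
    obtain ⟨hts, hst⟩ := hcon
    have hxc : ¬ G.Adj x c := fun h => hsc.ne (uniq x hx s c hs hc hxs h)
    have hxt : ¬ G.Adj x t := fun h => hts (uniq x hx s t hs ht hxs h).symm
    obtain ⟨w, hxw, hwt⟩ := hmid x t (fun h => hx (h ▸ ht)) hxt
    have hw : ¬ Infd G a b w := by
      intro hw
      have := uniq x hx s w hs hw hxs hxw
      exact hst (this ▸ hwt)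
    refine no_c5 hC5 x s c t w hxs.symm.symm hsc hct hwt.symm hxw.symm hxc hst ?_
      (fun h => hxt h.symm) ?_
    · exact fun h => hct.ne (uniq w hw c t hc ht h.symm hwt)
    · exact fun h => hts (uniq w hw s t hs ht h hwt).symm
  -- an attached vertex dominates the closure
  have dom : ∀ s x, Infd G a b s → ¬ Infd G a b x → G.Adj x s → ∀ t, Infd G a b t →
      t = s ∨ G.Adj s t := by
    intro s x hs hx hxs
    have ex : ∀ c t, Infd G a b c → Infd G a b t → G.Adj c t → (c = s ∨ G.Adj s c) →
        (t = s ∨ G.Adj s t) := by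
      intro c t hc ht hct h
      rcases h with rfl | h
      · exact Or.inr hct
      · exact nop s x hs hx hxs c t hc ht h hct
    have iffa : ∀ v, Infd G a b v → ((v = s ∨ G.Adj s v) ↔ (a = s ∨ G.Adj s a)) := by
      intro v hv
      induction hv with
      | left => exact Iff.rfl
      | right =>
        by_cases hadj : G.Adj a b
        · exact ⟨ex b a .right .left hadj.symm, ex a b .left .right hadj⟩
        · obtain ⟨c, hac, hcb⟩ := hmid a b hab hadj
          have hc : Infd G a b c := .step a b c hab hac.symm hcb .left .right
          exact ⟨fun h => ex c a hc .left hac.symm (ex b c .right hc hcb.symm h),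
            fun h => ex c b hc .right hcb (ex a c .left hc hac h)⟩
      | step p q v hpq hp hq ip iq ihp ihq =>
        have hv : Infd G a b v := .step p q v hpq hp hq ip iq
        rw [← ihp]
        exact ⟨ex v p hv ip hp, ex p v ip hv hp.symm⟩
    intro t ht
    exact (iffa t ht).2 ((iffa s hs).1 (Or.inl rfl))
  -- at most one attached vertex
  have one : ∀ s t x y, Infd G a b s → Infd G a b t → ¬ Infd G a b x → ¬ Infd G a b y →
      G.Adj x s → G.Adj y t → s = t := by
    intro s t x y hs ht hx hy hxs hyt
    by_contra hst
    have adj_st : G.Adj s t := (dom s x hs hx hxs t ht).resolve_left (Ne.symm hst)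
    have hxt : ¬ G.Adj x t := fun h => hst (uniq x hx s t hs ht hxs h)
    have hys : ¬ G.Adj y s := fun h => hst (uniq y hy s t hs ht h hyt)
    have hxy : x ≠ y := fun h => hxt (h ▸ hyt)
    by_cases hadj : G.Adj x y
    · have hsy : s ≠ y := fun h => hy (h ▸ hs)
      have ix : Infd G s y x := .step s y x hsy hxs hadj .left .right
      have it : Infd G s y t := .step s y t hsy adj_st.symm hyt.symm .left .right
      refine hx (hmax' s y hsy ?_ x ix)
      intro v hv
      by_cases h1 : v = s
      · exact h1 ▸ .left
      by_cases h2 : v = t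
      · exact h2 ▸ it
      have h3 := (dom s x hs hx hxs v hv).resolve_left h1
      have h4 := (dom t y ht hy hyt v hv).resolve_left h2
      exact .step s t v hst h3.symm h4.symm .left it
    · obtain ⟨w, hxw, hwy⟩ := hmid x y hxy hadj
      have hw : ¬ Infd G a b w := by
        intro hw
        have h1 := uniq x hx s w hs hw hxs hxw
        have h2 := uniq y hy t w ht hw hyt hwy.symm
        exact hst (h1.trans h2.symm)
      by_cases hws : G.Adj w s
      · have hwt : ¬ G.Adj w t := fun h => hst (uniq w hw s t hs ht hws h)
        have hsy : s ≠ y := fun h => hy (h ▸ hs)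
        have iw : Infd G s y w := .step s y w hsy hws hwy .left .right
        have it : Infd G s y t := .step s y t hsy adj_st.symm hyt.symm .left .right
        refine hw (hmax' s y hsy ?_ w iw)
        intro v hv
        by_cases h1 : v = s
        · exact h1 ▸ .left
        by_cases h2 : v = t
        · exact h2 ▸ it
        have h3 := (dom s x hs hx hxs v hv).resolve_left h1
        have h4 := (dom t y ht hy hyt v hv).resolve_left h2
        exact .step s t v hst h3.symm h4.symm .left it
      by_cases hwt : G.Adj w t
      · have htx : t ≠ x := fun h => hx (h ▸ ht)
        have iw : Infd G t x w := .step t x w htx hwt hxw.symm .left .right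
        have is : Infd G t x s := .step t x s htx adj_st hxs.symm .left .right
        refine hw (hmax' t x htx ?_ w iw)
        intro v hv
        by_cases h1 : v = s
        · exact h1 ▸ is
        by_cases h2 : v = t
        · exact h2 ▸ .left
        have h3 := (dom s x hs hx hxs v hv).resolve_left h1
        have h4 := (dom t y ht hy hyt v hv).resolve_left h2
        exact .step s t v hst h3.symm h4.symm is .left
      exact no_c5 hC5 s x w y t hxs.symm hxw hwy hyt adj_st.symm (fun h => hws h.symm) hadj hwt
        hys (fun h => hxt h.symm)
  -- there is an attached vertex
  obtain ⟨s, x, hs, hx, hxs⟩ : ∃ s x, Infd G a b s ∧ ¬ Infd G a b x ∧ G.Adj x s := by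
    by_cases h : G.Adj z a
    · exact ⟨a, z, .left, hz, h⟩
    · obtain ⟨w, hzw, hwa⟩ := hmid z a (fun h => hz (h ▸ .left)) h
      by_cases hw : Infd G a b w
      · exact ⟨w, z, hw, hz, hzw⟩
      · exact ⟨a, w, .left, hw, hwa⟩
  -- another vertex of the closure
  obtain ⟨t, ht, hts⟩ : ∃ t, Infd G a b t ∧ t ≠ s := by
    by_cases h : a = s
    · exact ⟨b, .right, fun h' => hab (h.trans h'.symm)⟩
    · exact ⟨a, .left, h⟩
  have sep1 : ∀ p q, Infd G a b p → ¬ Infd G a b q → p ≠ s → ¬ G.Adj p q := by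
    intro p q hp hq hps hpq
    exact hps (one p s q x hp hs hq hx hpq.symm hxs)
  have univ_s : ∀ v, v ≠ s → G.Adj s v := by
    intro v hvs
    by_cases hv : Infd G a b v
    · exact (dom s x hs hx hxs v hv).resolve_left hvs
    · obtain ⟨w, htw, hwv⟩ := hmid t v (fun h => hv (h ▸ ht)) (sep1 t v ht hv hts)
      by_cases hw : Infd G a b w
      · by_cases hws : w = s
        · exact hws ▸ hwv
        · exact absurd hwv (sep1 w v hw hv hws)
      · exact absurd htw (sep1 t w ht hw hts)
  have htx : t ≠ x := fun h => hx (h ▸ ht)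
  by_cases hall : ∀ v, Infd G t x v
  · exact good_of_infd htx hall
  push Not at hall
  obtain ⟨c, hc⟩ := hall
  have is : Infd G t x s := .step t x s htx (univ_s t hts) hxs.symm .left .right
  have hcs : c ≠ s := fun h => hc (h ▸ is)
  have hxs' : x ≠ s := hxs.ne
  have sep2 : ∀ p q, Infd G t x p → ¬ Infd G t x q → p ≠ s → q ≠ s → ¬ G.Adj p q := by
    intro p q hp hq hps hqs hpq
    exact hq (.step p s q hps hpq.symm (univ_s q hqs).symm hp is)
  obtain ⟨B1, hB1, hs1, ht1⟩ := exists_block (univ_s t hts)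
  obtain ⟨B2, hB2, hs2, hx2⟩ := exists_block (univ_s x hxs')
  obtain ⟨B3, hB3, hs3, hc3⟩ := exists_block (univ_s c hcs)
  have n12 : B1 ≠ B2 := by
    rintro rfl
    exact block_sep (P := {v | Infd G a b v}) hB1.1 hs1 ht1 hx2 hts hxs' ht hx
      fun p hp q hq hps _ => sep1 p q hp hq hps
  have n13 : B1 ≠ B3 := by
    rintro rfl
    exact block_sep (P := {v | Infd G t x v}) hB1.1 hs1 ht1 hc3 hts hcs .left hc
      fun p hp q hq hps hqs => sep2 p q hp hq hps hqs
  have n23 : B2 ≠ B3 := by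
    rintro rfl
    exact block_sep (P := {v | Infd G t x v}) hB2.1 hs2 hx2 hc3 hxs' hcs .right hc
      fun p hp q hq hps hqs => sep2 p q hp hq hps hqs
  have hsub : ({B1, B2, B3} : Set (Set V)) ⊆ {B | IsBlock G B} := by
    rintro B (rfl | rfl | rfl)
    exacts [hB1, hB2, hB3]
  have h3 := Set.ncard_le_ncard hsub (Set.toFinite _)
  rw [Set.ncard_eq_three.2 ⟨B1, B2, B3, n12, n13, n23, rfl⟩] at h3
  omega
end

section
/- Let G be a finite simple graph that is 2-connected. If G has diameter 2 and contains no induced cycle of length 5, then G is 2-bootstrap good. -/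
open SimpleGraph

variable {V : Type*}

theorem mem_percStep_of_two [Fintype V] (G : SimpleGraph V) {A : Set V} {x a b : V}
    (hab : a ≠ b) (ha : a ∈ A) (hb : b ∈ A) (hxa : G.Adj x a) (hxb : G.Adj x b) :
    x ∈ percStep G 2 A := by
  right
  have h : ({a, b} : Set V) ⊆ G.neighborSet x ∩ A := by
    rintro y (rfl | rfl)
    · exact ⟨hxa, ha⟩
    · exact ⟨hxb, hb⟩
  have := Set.ncard_le_ncard h (Set.toFinite _)
  rw [Set.ncard_pair hab] at this
  exact this

theorem subset_percStep (G : SimpleGraph V) (A : Set V) : A ⊆ percStep G 2 A :=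
  fun _ h => Or.inl h

theorem common_nbr (G : SimpleGraph V) (hconn : G.Connected) (hdiam : G.diam = 2) {x y : V}
    (hne : x ≠ y) (hadj : ¬ G.Adj x y) : ∃ z, G.Adj x z ∧ G.Adj z y := by
  have het : G.ediam ≠ ⊤ := by
    intro h
    rw [SimpleGraph.diam, h] at hdiam
    simp at hdiam
  have hd : G.dist x y ≤ 2 := hdiam ▸ SimpleGraph.dist_le_diam het
  obtain ⟨p, hp⟩ := hconn.exists_walk_length_eq_dist x y
  rw [← hp] at hd
  match p, hd with
  | .nil, _ => exact absurd rfl hne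
  | .cons h .nil, _ => exact absurd h hadj
  | .cons h (.cons h' .nil), _ => exact ⟨_, h, h'⟩
  | .cons _ (.cons _ (.cons _ _)), hd => simp at hd

theorem no_c5_s3 (G : SimpleGraph V) (hC5 : IsEmpty (cycleGraph 5 ↪g G)) {a b c d e : V}
    (hab : G.Adj a b) (hbc : G.Adj b c) (hcd : G.Adj c d) (hde : G.Adj d e) (hea : G.Adj e a)
    (hac : ¬ G.Adj a c) (hbd : ¬ G.Adj b d) (hce : ¬ G.Adj c e) (hda : ¬ G.Adj d a)
    (heb : ¬ G.Adj e b) : False := by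
  have hadj : ∀ i j : Fin 5, G.Adj (![a, b, c, d, e] i) (![a, b, c, d, e] j) ↔
      (cycleGraph 5).Adj i j := by
    intro i j
    have hd : (cycleGraph 5).Adj i j ↔ (i - j = 1 ∨ j - i = 1) := by
      simp [cycleGraph_adj]
    rw [hd]
    fin_cases i <;> fin_cases j <;> simp [*, G.adj_comm] <;>
      first
        | decide
        | grind [G.adj_comm]
  refine hC5.false ⟨⟨![a, b, c, d, e], ?_⟩, fun {i j} => hadj i j⟩
  intro i j hij
  have h : ∀ k, (cycleGraph 5).Adj i k ↔ (cycleGraph 5).Adj j k := by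
    intro k
    rw [← hadj, ← hadj, hij]
  have h' : ∀ i j : Fin 5, (∀ k, ((i - k = 1 ∨ k - i = 1) ↔ (j - k = 1 ∨ k - j = 1))) → i = j := by
    decide
  apply h'
  intro k
  simpa [cycleGraph_adj] using h k

/-- A non-full infected set coming from a pair can be enlarged by changing the pair. -/
theorem enlarge [Fintype V] (G : SimpleGraph V) (hconn : G.Connected)
    (hnocut : ∀ v : V, (G.induce {u | u ≠ v}).Connected) (hdiam : G.diam = 2)
    (hC5 : IsEmpty (cycleGraph 5 ↪g G)) (S : Set V) (hS2 : 2 ≤ S.ncard) (hSu : S ≠ Set.univ)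
    (hcl : percStep G 2 S ⊆ S) :
    ∃ A : Set V, A.ncard = 2 ∧ S ⊂ percIter G 2 A 2 := by
  have closed : ∀ {x a b : V}, x ∉ S → a ∈ S → b ∈ S → G.Adj x a → G.Adj x b → a = b := by
    intro x a b hx ha hb hxa hxb
    by_contra hab
    exact hx (hcl (mem_percStep_of_two G hab ha hb hxa hxb))
  obtain ⟨p, q, hp, hq, hpq⟩ := (Set.one_lt_ncard_iff (Set.toFinite S)).1 hS2
  obtain ⟨w, hw⟩ := (Set.ne_univ_iff_exists_notMem S).1 hSu
  -- edges between attached outside vertices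
  have key : ∀ {s t u v : V}, s ∈ S → t ∈ S → u ∉ S → v ∉ S → s ≠ t → G.Adj v s → G.Adj u t →
      G.Adj v u → G.Adj s t := by
    intro s t u v hs ht hu hv hst hvs hut hvu
    by_contra hn
    obtain ⟨c, hsc, hct⟩ := common_nbr G hconn hdiam hst hn
    have hc : c ∈ S := by
      by_contra hc
      exact hst (closed hc hs ht hsc.symm hct)
    refine no_c5_s3 G hC5 hsc hct hut.symm hvu.symm hvs hn ?_ ?_ ?_ ?_
    · exact fun h => hct.ne (closed hu hc ht h.symm hut)
    · exact fun h => hst (closed hv hs ht hvs h.symm)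
    · exact fun h => hst (closed hu hs ht h hut)
    · exact fun h => hsc.ne (closed hv hs hc hvs h)
  have univ : ∀ {s v x : V}, s ∈ S → v ∉ S → G.Adj v s → x ∈ S → s ≠ x → G.Adj s x := by
    intro s v x hs hv hvs hx hsx
    by_contra hn
    have h1 : ¬ G.Adj v x := fun h => hsx (closed hv hs hx hvs h)
    obtain ⟨u, hvu, hux⟩ := common_nbr G hconn hdiam (fun h : v = x => hv (h ▸ hx)) h1
    have hu : u ∉ S := by
      intro hu
      have := closed hv hs hu hvs hvu
      exact hn (this ▸ hux)
    exact hn (key hs hx hu hv hsx hvs hux hvu)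
  obtain ⟨W⟩ := hconn.preconnected p w
  obtain ⟨d, -, hd1, hd2⟩ := W.exists_boundary_dart S hp hw
  obtain ⟨⟨s, v⟩, hsv⟩ := d
  simp only at hd1 hd2 hsv
  obtain ⟨q', hq', hqs⟩ : ∃ q' ∈ S, q' ≠ s := by
    by_cases h : p = s
    · exact ⟨q, hq, fun h' => hpq (h.trans h'.symm)⟩
    · exact ⟨p, hp, h⟩
  have hvs : v ≠ s := fun h => hd2 (h ▸ hd1)
  obtain ⟨W'⟩ := (hnocut s).preconnected ⟨q', hqs⟩ ⟨v, hvs⟩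
  obtain ⟨d', -, hd1', hd2'⟩ := W'.exists_boundary_dart (Subtype.val ⁻¹' S) hq' hd2
  obtain ⟨⟨⟨t, hts⟩, ⟨u, hus⟩⟩, htu⟩ := d'
  simp only [Set.mem_preimage] at hd1' hd2'
  have htu' : G.Adj t u := htu
  have hts' : t ≠ s := hts
  have hst : G.Adj s t := univ hd1 hd2 hsv.symm hd1' hts'.symm
  have hvt : v ≠ t := fun h => hd2 (h ▸ hd1')
  refine ⟨{v, t}, Set.ncard_pair hvt, ?_⟩
  have e : percIter G 2 {v, t} 2 = percStep G 2 (percStep G 2 {v, t}) := rfl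
  rw [e]
  have hs1 : s ∈ percStep G 2 {v, t} :=
    mem_percStep_of_two G hvt (by simp) (by simp) hsv hst
  have ht1 : t ∈ percStep G 2 {v, t} := subset_percStep _ _ (by simp)
  have hv1 : v ∈ percStep G 2 {v, t} := subset_percStep _ _ (by simp)
  refine ⟨?_, fun h => hd2 (h (subset_percStep _ _ hv1))⟩
  intro x hx
  by_cases hxs : s = x
  · exact subset_percStep _ _ (hxs ▸ hs1)
  by_cases hxt : t = x
  · exact subset_percStep _ _ (hxt ▸ ht1)
  exact mem_percStep_of_two G hts'.symm hs1 ht1 (univ hd1 hd2 hsv.symm hx hxs).symm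
    (univ hd1' hd2' htu'.symm hx hxt).symm

/-- A finite 2-connected graph (at least 3 vertices, connected, no cut vertex) with
diameter 2 and no induced 5-cycle is 2-bootstrap good. -/
theorem stmt_3 {V : Type*} [Fintype V] (G : SimpleGraph V)
    (hcard : 3 ≤ Fintype.card V) (hconn : G.Connected)
    (hnocut : ∀ v : V, (G.induce {u | u ≠ v}).Connected)
    (hdiam : G.diam = 2)
    (hC5 : IsEmpty (cycleGraph 5 ↪g G)) :
    BootstrapGood G 2 := by
  let N : Set ℕ := {n | ∃ (A : Set V) (t : ℕ), A.ncard = 2 ∧ (percIter G 2 A t).ncard = n}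
  have hbd : BddAbove N := by
    refine ⟨Fintype.card V, ?_⟩
    rintro n ⟨A, t, -, rfl⟩
    rw [← Nat.card_eq_fintype_card]
    exact Set.ncard_le_card _
  have hne : N.Nonempty := by
    obtain ⟨a, b, hab⟩ := Fintype.exists_pair_of_one_lt_card (α := V) (by omega)
    exact ⟨_, {a, b}, 0, Set.ncard_pair hab, rfl⟩
  obtain ⟨A, t, hA, hmax⟩ := Nat.sSup_mem hne hbd
  refine ⟨A, hA, t, ?_⟩
  by_contra hSu
  have hle : ∀ (B : Set V) (k : ℕ), B.ncard = 2 →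
      (percIter G 2 B k).ncard ≤ (percIter G 2 A t).ncard := by
    intro B k hB
    rw [hmax]
    exact le_csSup hbd ⟨B, k, hB, rfl⟩
  have hcl : percStep G 2 (percIter G 2 A t) ⊆ percIter G 2 A t :=
    (Set.eq_of_subset_of_ncard_le (subset_percStep G _) (hle A (t + 1) hA)).ge
  have hS2 : 2 ≤ (percIter G 2 A t).ncard := by
    have := hle A 0 hA
    rwa [percIter, hA] at this
  obtain ⟨B, hB, hlt⟩ := enlarge G hconn hnocut hdiam hC5 _ hS2 hSu hcl
  exact absurd (hle B 2 hB) (not_le.2 (Set.ncard_lt_ncard hlt))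
end

section
/- Let G be a finite connected simple graph with at least r + 1 vertices, let A₀ be a percolating set of G of cardinality r under r-bootstrap percolation, and let X be a cut set of G with |X| < r. Then every component C of G − X whose vertex set is not contained in A₀ satisfies |V(C) ∩ A₀| ≥ r − |X|. -/
open SimpleGraph

variable {V : Type*}

/-- `X` is a cut set of `G`: deleting `X` disconnects the graph. -/
def IsCutSet (G : SimpleGraph V) (X : Set V) : Prop :=
  ¬ (G.induce {v | v ∉ X}).Connected

/-- Every component of `G - X` not contained in `A₀` contains at least `r - |X|`
vertices of `A₀`. -/
theorem stmt_4 {V : Type*} [Fintype V] (G : SimpleGraph V) (r : ℕ)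
    (hconn : G.Connected) (hcard : r + 1 ≤ Fintype.card V)
    (A₀ : Set V) (hA₀ : A₀.ncard = r) (hperc : Percolates G r A₀)
    (X : Set V) (hX : IsCutSet G X) (hXcard : X.ncard < r)
    (C : (G.induce {v | v ∉ X}).ConnectedComponent)
    (hC : ¬ Subtype.val '' C.supp ⊆ A₀) :
    r - X.ncard ≤ (Subtype.val '' C.supp ∩ A₀).ncard := by
  obtain ⟨T, hT⟩ := hperc
  by_contra hlt
  have key : ∀ t, Subtype.val '' C.supp ∩ percIter G r A₀ t ⊆ A₀ := by
    intro t
    induction t with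
    | zero => exact fun v hv => hv.2
    | succ t ih =>
      rintro v ⟨hvC, hv⟩
      rcases hv with hv | hv
      · exact ih ⟨hvC, hv⟩
      · exfalso
        apply hlt
        have hsub : G.neighborSet v ∩ percIter G r A₀ t ⊆
            X ∪ (Subtype.val '' C.supp ∩ A₀) := by
          rintro w ⟨hw, hwt⟩
          by_cases hwX : w ∈ X
          · exact Or.inl hwX
          · right
            obtain ⟨v', hv', rfl⟩ := hvC
            have hwC : w ∈ Subtype.val '' C.supp := by
              refine ⟨⟨w, hwX⟩, ?_, rfl⟩
              have hadj : (G.induce {v | v ∉ X}).Adj ⟨w, hwX⟩ v' := by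
                simpa using G.adj_symm hw
              rw [ConnectedComponent.mem_supp_iff] at hv' ⊢
              rw [← hv']
              exact ConnectedComponent.sound hadj.reachable
            exact ⟨hwC, ih ⟨hwC, hwt⟩⟩
        have h1 := Set.ncard_le_ncard hsub (Set.toFinite _)
        have h2 := Set.ncard_union_le X (Subtype.val '' C.supp ∩ A₀)
        have h3 : r ≤ (G.neighborSet v ∩ percIter G r A₀ t).ncard := hv
        omega
  apply hC
  intro v hv
  exact key T ⟨hv, by rw [hT]; trivial⟩
end

section
/- Let G be a finite connected simple graph with at least r + 1 vertices, let A₀ be a percolating set of G of cardinality r under r-bootstrap percolation, let X be a cut set of G with |X| < r, and let K be the set of components of G − X whose vertex sets are not contained in A₀. Then |K| ≤ ⌊r/(r − |X|)⌋. -/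
open SimpleGraph

variable {V : Type*}

theorem comp_bound {V : Type*} [Fintype V] (G : SimpleGraph V) (r : ℕ)
    (A₀ : Set V) (hperc : Percolates G r A₀) (X : Set V)
    (C : (G.induce {v | v ∉ X}).ConnectedComponent)
    (hC : ¬ Subtype.val '' C.supp ⊆ A₀) :
    r ≤ X.ncard + (A₀ ∩ Subtype.val '' C.supp).ncard := by
  by_contra hlt
  push Not at hlt
  obtain ⟨t, ht⟩ := hperc
  have key : ∀ n, percIter G r A₀ n ∩ Subtype.val '' C.supp ⊆ A₀ := by
    intro n
    induction n with
    | zero => exact Set.inter_subset_left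
    | succ n ih =>
      rintro v ⟨hv, hvC⟩
      rcases hv with hv | hv
      · exact ih ⟨hv, hvC⟩
      · exfalso
        have hsub : G.neighborSet v ∩ percIter G r A₀ n ⊆
            X ∪ (A₀ ∩ Subtype.val '' C.supp) := by
          rintro w ⟨hvw, hw⟩
          by_cases hwX : w ∈ X
          · exact Or.inl hwX
          · right
            have hwC : w ∈ Subtype.val '' C.supp := by
              obtain ⟨v', hv', rfl⟩ := hvC
              refine ⟨⟨w, hwX⟩, ?_, rfl⟩
              have hadj : (G.induce {v | v ∉ X}).Adj v' ⟨w, hwX⟩ := hvw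
              rw [ConnectedComponent.mem_supp_iff] at hv' ⊢
              rw [← hv']
              exact ConnectedComponent.sound hadj.symm.reachable
            exact ⟨ih ⟨hw, hwC⟩, hwC⟩
        have h1 := Set.ncard_le_ncard hsub (Set.toFinite _)
        have h2 := Set.ncard_union_le X (A₀ ∩ Subtype.val '' C.supp)
        have h3 : r ≤ (G.neighborSet v ∩ percIter G r A₀ n).ncard := hv
        omega
  apply hC
  have := key t
  rwa [ht, Set.univ_inter] at this

/-- The number of components of `G - X` not contained in `A₀` is at most
`⌊r / (r - |X|)⌋`. -/
theorem stmt_5 {V : Type*} [Fintype V] (G : SimpleGraph V) (r : ℕ)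
    (hconn : G.Connected) (hcard : r + 1 ≤ Fintype.card V)
    (A₀ : Set V) (hA₀ : A₀.ncard = r) (hperc : Percolates G r A₀)
    (X : Set V) (hX : IsCutSet G X) (hXcard : X.ncard < r) :
    {C : (G.induce {v | v ∉ X}).ConnectedComponent |
        ¬ Subtype.val '' C.supp ⊆ A₀}.ncard ≤ r / (r - X.ncard) := by
  classical
  rw [Nat.le_div_iff_mul_le (by omega)]
  set K := {C : (G.induce {v | v ∉ X}).ConnectedComponent |
        ¬ Subtype.val '' C.supp ⊆ A₀} with hK
  have hKf : K.Finite := Set.toFinite K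
  have hb : ∀ C ∈ hKf.toFinset,
      r - X.ncard ≤ (A₀ ∩ Subtype.val '' C.supp).toFinset.card := by
    intro C hC
    have h := comp_bound G r A₀ hperc X C (by simpa [hK] using hC)
    rw [Set.ncard_eq_toFinset_card' (A₀ ∩ _)] at h
    omega
  have hs := Finset.card_nsmul_le_sum _ _ _ hb
  rw [← Finset.card_biUnion] at hs
  · rw [Set.ncard_eq_toFinset_card K hKf]
    refine le_trans hs ?_
    rw [← hA₀, Set.ncard_eq_toFinset_card' A₀]
    apply Finset.card_le_card
    intro v hv
    simp only [Finset.mem_biUnion, Set.mem_toFinset] at hv ⊢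
    obtain ⟨C, -, hv⟩ := hv
    exact hv.1
  · intro C _ D _ hCD
    rw [Function.onFun, Set.disjoint_toFinset, Set.disjoint_left]
    rintro v ⟨-, a, ha, rfl⟩ ⟨-, b, hb, hab⟩
    obtain rfl := Subtype.val_injective hab
    exact hCD (ha.symm.trans hb)
end

section
/- Let G be a finite connected simple graph with at least r + 1 vertices, let A₀ be a percolating set of G of cardinality r under r-bootstrap percolation, let X be a cut set of G with |X| < r, and let K be the set of components of G − X whose vertex sets are not contained in A₀. If |K| ≥ 2, then r ≤ 2|X| (so that r/2 ≤ |X| ≤ r − 1). -/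
open SimpleGraph

variable {V : Type*}

theorem perc_component_bound {V : Type*} [Fintype V] (G : SimpleGraph V) (r : ℕ)
    (A : Set V) (hperc : Percolates G r A) (X S : Set V)
    (hS : ∀ v ∈ S, ∀ w, G.Adj v w → w ∈ S ∪ X) (hne : ¬ S ⊆ A) :
    r ≤ (A ∩ S).ncard + X.ncard := by
  by_contra hlt
  push Not at hlt
  have key : ∀ t, percIter G r A t ∩ S ⊆ A := by
    intro t
    induction t with
    | zero => exact fun v hv => hv.1
    | succ t ih =>
      rintro v ⟨hv | hv, hvS⟩
      · exact ih ⟨hv, hvS⟩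
      · exfalso
        have hsub : G.neighborSet v ∩ percIter G r A t ⊆ (A ∩ S) ∪ X := by
          rintro w ⟨hw, hwt⟩
          rcases hS v hvS w hw with h | h
          · exact Or.inl ⟨ih ⟨hwt, h⟩, h⟩
          · exact Or.inr h
        have h1 := Set.ncard_le_ncard hsub (Set.toFinite _)
        have h2 := Set.ncard_union_le (A ∩ S) X
        have h3 : r ≤ (G.neighborSet v ∩ percIter G r A t).ncard := hv
        omega
  obtain ⟨t, ht⟩ := hperc
  exact hne fun v hv => key t ⟨by rw [ht]; trivial, hv⟩

theorem component_closed {V : Type*} (G : SimpleGraph V) (X : Set V)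
    (C : (G.induce {v | v ∉ X}).ConnectedComponent) :
    ∀ v ∈ Subtype.val '' C.supp, ∀ w, G.Adj v w → w ∈ Subtype.val '' C.supp ∪ X := by
  rintro _ ⟨v, hv, rfl⟩ w hw
  by_cases hX : w ∈ X
  · exact Or.inr hX
  · refine Or.inl ⟨⟨w, hX⟩, ?_, rfl⟩
    have hadj : (G.induce {v | v ∉ X}).Adj v ⟨w, hX⟩ := hw
    exact (C.mem_supp_congr_adj hadj).1 hv

/-- If at least two components of `G - X` are not contained in `A₀`, then
`r ≤ 2|X|` (so that `r/2 ≤ |X| ≤ r - 1`). -/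
theorem stmt_6 {V : Type*} [Fintype V] (G : SimpleGraph V) (r : ℕ)
    (hconn : G.Connected) (hcard : r + 1 ≤ Fintype.card V)
    (A₀ : Set V) (hA₀ : A₀.ncard = r) (hperc : Percolates G r A₀)
    (X : Set V) (hX : IsCutSet G X) (hXcard : X.ncard < r)
    (hK : 2 ≤ {C : (G.induce {v | v ∉ X}).ConnectedComponent |
        ¬ Subtype.val '' C.supp ⊆ A₀}.ncard) :
    r ≤ 2 * X.ncard := by
  obtain ⟨C, hC, D, hD, hCD⟩ := (Set.one_lt_ncard (Set.toFinite _)).1 hK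
  have h1 := perc_component_bound G r A₀ hperc X _ (component_closed G X C) hC
  have h2 := perc_component_bound G r A₀ hperc X _ (component_closed G X D) hD
  have hdisj : Disjoint (A₀ ∩ Subtype.val '' C.supp) (A₀ ∩ Subtype.val '' D.supp) := by
    rw [Set.disjoint_left]
    rintro _ ⟨_, v, hv, rfl⟩ ⟨_, w, hw, hvw⟩
    obtain rfl := Subtype.val_injective hvw
    exact hCD (hv.symm.trans hw)
  have h3 := Set.ncard_union_eq hdisj (Set.toFinite _) (Set.toFinite _)
  have h4 : (A₀ ∩ Subtype.val '' C.supp ∪ A₀ ∩ Subtype.val '' D.supp).ncard ≤ A₀.ncard :=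
    Set.ncard_le_ncard (Set.union_subset Set.inter_subset_left Set.inter_subset_left)
      (Set.toFinite _)
  omega
end

section
/- Let G be a finite connected simple graph with at least r + 1 vertices, let A₀ be a percolating set of G of cardinality r under r-bootstrap percolation, and let X be a cut set of G with |X| < r. Then at least one vertex of X is adjacent to every vertex of A₀. -/
open SimpleGraph

variable {V : Type*}

theorem meets_comp {V : Type*} [Fintype V] (G : SimpleGraph V) (r : ℕ)
    (A₀ : Set V) (hperc : Percolates G r A₀)
    (X : Set V) (hXcard : X.ncard < r) (w : {v | v ∉ X}) :
    ∃ a : {v | v ∉ X}, a.1 ∈ A₀ ∧ (G.induce {v | v ∉ X}).Reachable w a := by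
  by_contra hcon
  push Not at hcon
  obtain ⟨t, ht⟩ := hperc
  have key : ∀ t, ∀ a : {v | v ∉ X}, a.1 ∈ percIter G r A₀ t →
      ¬ (G.induce {v | v ∉ X}).Reachable w a := by
    intro t
    induction t with
    | zero => exact hcon
    | succ t ih =>
      intro a ha hr
      rcases ha with ha | ha
      · exact ih a ha hr
      · have ha' : r ≤ (G.neighborSet a.1 ∩ percIter G r A₀ t).ncard := ha
        have hsub : G.neighborSet a.1 ∩ percIter G r A₀ t ⊆ X := by
          rintro y ⟨hy, hyt⟩
          by_contra hyX
          have hadj : (G.induce {v | v ∉ X}).Adj a ⟨y, hyX⟩ := hy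
          exact ih ⟨y, hyX⟩ hyt (hr.trans hadj.reachable)
        have := Set.ncard_le_ncard hsub (Set.toFinite X)
        omega
  exact key t w (by rw [ht]; trivial) (Reachable.refl w)

/-- At least one vertex of the cut set `X` is adjacent to every vertex of `A₀`. -/
theorem stmt_7 {V : Type*} [Fintype V] (G : SimpleGraph V) (r : ℕ)
    (hconn : G.Connected) (hcard : r + 1 ≤ Fintype.card V)
    (A₀ : Set V) (hA₀ : A₀.ncard = r) (hperc : Percolates G r A₀)
    (X : Set V) (hX : IsCutSet G X) (hXcard : X.ncard < r) :
    ∃ x ∈ X, ∀ a ∈ A₀, G.Adj x a := by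
  by_contra hno
  push Not at hno
  have hs : ∃ s, ∀ a ∈ A₀, G.Adj s a := by
    by_contra hcon
    push Not at hcon
    obtain ⟨t, ht⟩ := hperc
    have key : ∀ t, percIter G r A₀ t = A₀ := by
      intro t
      induction t with
      | zero => rfl
      | succ t ih =>
        show percStep G r (percIter G r A₀ t) = A₀
        rw [ih]
        refine Set.union_eq_self_of_subset_right ?_
        intro v hv
        have hv' : r ≤ (G.neighborSet v ∩ A₀).ncard := hv
        have heq : G.neighborSet v ∩ A₀ = A₀ :=
          Set.eq_of_subset_of_ncard_le Set.inter_subset_right (by omega) (Set.toFinite _)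
        obtain ⟨a, ha, hna⟩ := hcon v
        rw [← heq] at ha
        exact absurd ha.1 hna
    rw [key t] at ht
    rw [ht, Set.ncard_univ, Nat.card_eq_fintype_card] at hA₀
    omega
  obtain ⟨s, hs⟩ := hs
  have hsX : s ∉ X := by
    intro h
    obtain ⟨a, ha, hna⟩ := hno s h
    exact hna (hs a ha)
  have hreach : ∀ w, (G.induce {v | v ∉ X}).Reachable w ⟨s, hsX⟩ := by
    intro w
    obtain ⟨a, ha, hr⟩ := meets_comp G r A₀ hperc X hXcard w
    have hadj : (G.induce {v | v ∉ X}).Adj a ⟨s, hsX⟩ := (hs a.1 ha).symm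
    exact hr.trans hadj.reachable
  apply hX
  haveI : Nonempty {v | v ∉ X} := ⟨⟨s, hsX⟩⟩
  exact Connected.mk fun u v => (hreach u).trans (hreach v).symm
end

section
/- Let G be a finite connected simple graph with at least r + 1 vertices, let A₀ be a percolating set of G of cardinality r under r-bootstrap percolation, and let X be a cut set of G with |X| < r. Then X is not a subset of A₀. -/
open SimpleGraph

variable {V : Type*}

/-- The cut set `X` is not a subset of `A₀`. -/
theorem stmt_8 {V : Type*} [Fintype V] (G : SimpleGraph V) (r : ℕ)
    (hconn : G.Connected) (hcard : r + 1 ≤ Fintype.card V)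
    (A₀ : Set V) (hA₀ : A₀.ncard = r) (hperc : Percolates G r A₀)
    (X : Set V) (hX : IsCutSet G X) (hXcard : X.ncard < r) :
    ¬ X ⊆ A₀ := by
  intro hsub
  obtain ⟨t, ht⟩ := hperc
  -- a vertex infected in the first round
  have hv : ∃ v, v ∉ A₀ ∧ r ≤ (G.neighborSet v ∩ A₀).ncard := by
    by_contra hno
    push Not at hno
    have hfix : ∀ s, percIter G r A₀ s = A₀ := by
      intro s
      induction s with
      | zero => rfl
      | succ s ih =>
        show percStep G r (percIter G r A₀ s) = A₀
        rw [ih]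
        ext w
        constructor
        · rintro (h | h)
          · exact h
          · by_contra hw
            exact absurd (hno w hw) (not_lt.mpr h)
        · exact fun h => Or.inl h
    rw [hfix] at ht
    rw [ht, Set.ncard_univ, Nat.card_eq_fintype_card] at hA₀
    omega
  obtain ⟨v, hvA, hvr⟩ := hv
  have hNA : G.neighborSet v ∩ A₀ = A₀ :=
    Set.eq_of_subset_of_ncard_le Set.inter_subset_right (by omega) (Set.toFinite _)
  have hadj : ∀ w ∈ A₀, G.Adj v w := fun w hw => by
    rw [← hNA] at hw
    exact hw.1
  have hvX : v ∉ X := fun h => hvA (hsub h)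
  have key : ∀ s, ∀ w ∈ percIter G r A₀ s, ∀ hw : w ∉ X,
      (G.induce {v | v ∉ X}).Reachable ⟨v, hvX⟩ ⟨w, hw⟩ := by
    intro s
    induction s with
    | zero =>
      intro w hwA hw
      exact SimpleGraph.Adj.reachable (by simpa using hadj w hwA)
    | succ s ih =>
      intro w hwA hw
      rcases hwA with h | h
      · exact ih w h hw
      · have hns : ¬ (G.neighborSet w ∩ percIter G r A₀ s) ⊆ X := fun hss => by
          have h1 := Set.ncard_le_ncard hss (Set.toFinite _)
          have h2 : r ≤ (G.neighborSet w ∩ percIter G r A₀ s).ncard := h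
          omega
        obtain ⟨u, ⟨hu1, hu2⟩, huX⟩ := Set.not_subset.mp hns
        refine (ih u hu2 huX).trans (SimpleGraph.Adj.reachable ?_)
        have hu3 : G.Adj w u := hu1
        simpa using hu3.symm
  apply hX
  have hall : ∀ w : {v | v ∉ X}, (G.induce {v | v ∉ X}).Reachable ⟨v, hvX⟩ w :=
    fun w => key t w.1 (by rw [ht]; trivial) w.2
  haveI : Nonempty {v | v ∉ X} := ⟨⟨v, hvX⟩⟩
  exact SimpleGraph.Connected.mk (fun a b => (hall a).symm.trans (hall b))
end

section
/- Let r ≥ 2 and let G be a finite connected simple graph with at least r + 1 vertices that is r-bootstrap good. Then G has at most one cut vertex. -/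
open SimpleGraph

variable {V : Type*}

/-- `v` is a cut vertex: its deletion disconnects the graph. -/
def IsCutVertex (G : SimpleGraph V) (v : V) : Prop :=
  ¬ (G.induce {u | u ≠ v}).Connected

theorem cut_eq_first {V : Type*} [Fintype V] (G : SimpleGraph V) (r : ℕ) (hr : 2 ≤ r)
    (A : Set V) (hP : Percolates G r A) (w : V) (hw : ∀ a ∈ A, G.Adj w a) (u : V)
    (hu : IsCutVertex G u) : u = w := by
  by_contra hne
  have hwu : w ≠ u := fun h => hne h.symm
  apply hu
  let w' : {x | x ≠ u} := ⟨w, hwu⟩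
  have key : ∀ t, ∀ x ∈ percIter G r A t, ∀ hx : x ≠ u,
      (G.induce {x | x ≠ u}).Reachable w' ⟨x, hx⟩ := by
    intro t
    induction t with
    | zero =>
      intro x hxA hx
      apply SimpleGraph.Adj.reachable
      exact hw x hxA
    | succ t ih =>
      intro x hxA hx
      rcases hxA with h | h
      · exact ih x h hx
      · have h1 : 1 < (G.neighborSet x ∩ percIter G r A t).ncard :=
          lt_of_lt_of_le hr h
        obtain ⟨y, hy, hyu⟩ := Set.exists_ne_of_one_lt_ncard h1 u
        refine (ih y hy.2 hyu).trans (SimpleGraph.Adj.reachable ?_)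
        exact SimpleGraph.Adj.symm (show G.Adj x y from hy.1)
  obtain ⟨t, ht⟩ := hP
  have all : ∀ x : {x | x ≠ u}, (G.induce {x | x ≠ u}).Reachable w' x := by
    intro x
    exact key t x.1 (ht ▸ Set.mem_univ _) x.2
  exact { preconnected := fun x y => (all x).symm.trans (all y), nonempty := ⟨w'⟩ }

/-- For `r ≥ 2`, an `r`-bootstrap good connected graph with at least `r + 1`
vertices has at most one cut vertex. -/
theorem stmt_9 {V : Type*} [Fintype V] (G : SimpleGraph V) (r : ℕ) (hr : 2 ≤ r)
    (hconn : G.Connected) (hcard : r + 1 ≤ Fintype.card V)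
    (hBG : BootstrapGood G r) :
    ∀ u v : V, IsCutVertex G u → IsCutVertex G v → u = v := by
  obtain ⟨A, hA, hP⟩ := hBG
  have hex : ∃ w, ∀ a ∈ A, G.Adj w a := by
    by_contra hno
    have stuck : ∀ t, percIter G r A t = A := by
      intro t
      induction t with
      | zero => rfl
      | succ t ih =>
        change percStep G r (percIter G r A t) = A
        rw [ih]
        apply Set.union_eq_self_of_subset_right
        intro w hw
        exfalso
        apply hno
        refine ⟨w, fun a ha => ?_⟩
        have hw' : r ≤ (G.neighborSet w ∩ A).ncard := hw
        have heq : G.neighborSet w ∩ A = A :=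
          Set.eq_of_subset_of_ncard_le Set.inter_subset_right (by omega) (Set.toFinite A)
        rw [← heq] at ha
        exact ha.1
    obtain ⟨t, ht⟩ := hP
    rw [stuck t] at ht
    rw [ht, Set.ncard_univ, Nat.card_eq_fintype_card] at hA
    omega
  obtain ⟨w, hw⟩ := hex
  intro u v hu hv
  rw [cut_eq_first G r hr A hP w hw u hu, cut_eq_first G r hr A hP w hw v hv]
end

section
/- Let r ≥ 2 and let G be a finite connected simple graph with at least r + 1 vertices that is r-bootstrap good. Then G contains at most r blocks. -/
open SimpleGraph

variable {V : Type*}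

/-- `a` and `b` are joined by a walk inside `S`. -/
def Rch (G : SimpleGraph V) (S : Set V) (a b : V) : Prop :=
  ∃ p : G.Walk a b, ∀ x ∈ p.support, x ∈ S

theorem Rch.mono {G : SimpleGraph V} {S T : Set V} {a b : V} (h : Rch G S a b) (hST : S ⊆ T) :
    Rch G T a b := by
  obtain ⟨p, hp⟩ := h
  exact ⟨p, fun x hx => hST (hp x hx)⟩

theorem Rch.symm {G : SimpleGraph V} {S : Set V} {a b : V} (h : Rch G S a b) : Rch G S b a := by
  obtain ⟨p, hp⟩ := h
  exact ⟨p.reverse, fun x hx => hp x (by simpa using hx)⟩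

theorem Rch.trans {G : SimpleGraph V} {S : Set V} {a b c : V} (h : Rch G S a b)
    (h' : Rch G S b c) : Rch G S a c := by
  obtain ⟨p, hp⟩ := h
  obtain ⟨q, hq⟩ := h'
  refine ⟨p.append q, fun x hx => ?_⟩
  rw [Walk.mem_support_append_iff] at hx
  exact hx.elim (hp x) (hq x)

theorem Rch.refl {G : SimpleGraph V} {S : Set V} {a : V} (h : a ∈ S) : Rch G S a a :=
  ⟨Walk.nil, by simpa using h⟩

theorem Rch.adj {G : SimpleGraph V} {S : Set V} {a b : V} (h : G.Adj a b) (ha : a ∈ S)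
    (hb : b ∈ S) : Rch G S a b :=
  ⟨Walk.cons h Walk.nil, by simp [ha, hb]⟩

theorem rch_iff {G : SimpleGraph V} {S : Set V} (a b : ↥S) :
    (G.induce S).Reachable a b ↔ Rch G S a b := by
  constructor
  · rintro ⟨p⟩
    induction p with
    | nil => exact Rch.refl (Subtype.property _)
    | cons h _ ih => exact (Rch.adj (G := G) (S := S) (induce_adj.1 h) (Subtype.property _) (Subtype.property _)).trans ih
  · rintro ⟨p, hp⟩
    exact ⟨p.induce S hp⟩

theorem blockPred_iff {G : SimpleGraph V} {B : Set V} :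
    BlockPred G B ↔ B.Nonempty ∧ (∀ a ∈ B, ∀ b ∈ B, Rch G B a b) ∧
      ∀ v ∈ B, ∀ a ∈ B \ {v}, ∀ b ∈ B \ {v}, Rch G (B \ {v}) a b := by
  unfold BlockPred
  constructor
  · rintro ⟨h1, h2⟩
    refine ⟨?_, fun a ha b hb => (rch_iff ⟨a, ha⟩ ⟨b, hb⟩).1 (h1.preconnected _ _),
      fun v hv a ha b hb => (rch_iff ⟨a, ha⟩ ⟨b, hb⟩).1 (h2 v hv _ _)⟩
    obtain ⟨x⟩ := h1.nonempty
    exact ⟨x, x.2⟩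
  · rintro ⟨⟨x, hx⟩, h1, h2⟩
    refine ⟨?_, fun v hv a b => (rch_iff a b).2 (h2 v hv a a.2 b b.2)⟩
    haveI : Nonempty ↥B := ⟨⟨x, hx⟩⟩
    exact Connected.mk (fun a b => (rch_iff a b).2 (h1 a a.2 b b.2))

/-- Adding an ear to a set without cut vertices. -/
theorem blockPred_ear {G : SimpleGraph V} {B : Set V} (hB : BlockPred G B) {a b : V}
    (ha : a ∈ B) (hb : b ∈ B) (hab : a ≠ b) (p : G.Walk a b) (hp : p.IsPath) :
    BlockPred G (B ∪ {x | x ∈ p.support}) := by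
  classical
  rw [blockPred_iff] at hB ⊢
  obtain ⟨h0, h1, h2⟩ := hB
  have hsub : B ⊆ B ∪ {x | x ∈ p.support} := Set.subset_union_left
  refine ⟨h0.mono hsub, ?_, ?_⟩
  · have key : ∀ x ∈ B ∪ {x | x ∈ p.support}, Rch G (B ∪ {x | x ∈ p.support}) x a := by
      rintro x (hx | hx)
      · exact (h1 x hx a ha).mono hsub
      · refine Rch.symm ⟨p.takeUntil x hx, fun y hy => Or.inr ?_⟩
        exact p.support_takeUntil_subset_support hx hy
    exact fun x hx y hy => (key x hx).trans (key y hy).symm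
  · intro v _ 
    have hsub' : B \ {v} ⊆ (B ∪ {x | x ∈ p.support}) \ {v} :=
      Set.diff_subset_diff_left hsub
    have key : ∀ x ∈ (B ∪ {x | x ∈ p.support}) \ {v}, ∃ c ∈ B \ {v},
        Rch G ((B ∪ {x | x ∈ p.support}) \ {v}) x c := by
      rintro x ⟨hx | hx, hxv⟩
      · exact ⟨x, ⟨hx, hxv⟩, Rch.refl ⟨Or.inl hx, hxv⟩⟩
      · by_cases hv : v ∈ (p.takeUntil x hx).support
        · have hv' : v ∉ (p.dropUntil x hx).support := by
            intro hv'
            have hd := hp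
            rw [← p.take_spec hx] at hd
            have := hd.support_nodup
            rw [Walk.support_append, List.nodup_append] at this
            have h3 : v ∈ (p.dropUntil x hx).support.tail := by
              rw [Walk.support_eq_cons] at hv'
              rcases List.mem_cons.1 hv' with h | h
              · exact absurd h.symm hxv
              · exact h
            exact this.2.2 v hv v h3 rfl
          refine ⟨b, ⟨hb, ?_⟩, p.dropUntil x hx, fun y hy =>
            ⟨Or.inr (p.support_dropUntil_subset_support hx hy), ?_⟩⟩
          · rintro rfl
            exact hv' (Walk.end_mem_support _)
          · rintro rfl
            exact hv' hy
        · refine ⟨a, ⟨ha, ?_⟩, Rch.symm ⟨p.takeUntil x hx, fun y hy =>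
            ⟨Or.inr (p.support_takeUntil_subset_support hx hy), ?_⟩⟩⟩
          · rintro rfl
            exact hv (Walk.start_mem_support _)
          · rintro rfl
            exact hv hy
    have h2' : ∀ c ∈ B \ {v}, ∀ d ∈ B \ {v}, Rch G (B \ {v}) c d := by
      by_cases hvB : v ∈ B
      · exact h2 v hvB
      · rw [Set.diff_singleton_eq_self hvB]
        exact h1
    intro x hx y hy
    obtain ⟨c, hc, hxc⟩ := key x hx
    obtain ⟨d, hd, hyd⟩ := key y hy
    exact (hxc.trans ((h2' c hc d hd).mono hsub')).trans hyd.symm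

theorem IsBlock.path_mem {G : SimpleGraph V} {B : Set V} (hB : IsBlock G B) {a b : V}
    (ha : a ∈ B) (hb : b ∈ B) (hab : a ≠ b) (p : G.Walk a b) (hp : p.IsPath) {x : V}
    (hx : x ∈ p.support) : x ∈ B := by
  have := hB.2 _ Set.subset_union_left (blockPred_ear hB.1 ha hb hab p hp)
  rw [← this]
  exact Or.inr hx

theorem blockPred_union {G : SimpleGraph V} {B C : Set V} (hB : BlockPred G B)
    (hC : BlockPred G C) {a b : V} (hab : a ≠ b) (haB : a ∈ B) (hbB : b ∈ B) (haC : a ∈ C)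
    (hbC : b ∈ C) : BlockPred G (B ∪ C) := by
  rw [blockPred_iff] at hB hC ⊢
  have gen : ∀ D : Set V, (∀ a ∈ D, ∀ b ∈ D, Rch G D a b) →
      (∀ v ∈ D, ∀ a ∈ D \ {v}, ∀ b ∈ D \ {v}, Rch G (D \ {v}) a b) →
      ∀ v, ∀ a ∈ D \ {v}, ∀ b ∈ D \ {v}, Rch G (D \ {v}) a b := by
    intro D h1 h2 v
    by_cases hvB : v ∈ D
    · exact h2 v hvB
    · rw [Set.diff_singleton_eq_self hvB]
      exact h1
  refine ⟨hB.1.mono Set.subset_union_left, ?_, ?_⟩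
  · have key : ∀ x ∈ B ∪ C, Rch G (B ∪ C) x a := by
      rintro x (hx | hx)
      · exact (hB.2.1 x hx a haB).mono Set.subset_union_left
      · exact (hC.2.1 x hx a haC).mono Set.subset_union_right
    exact fun x hx y hy => (key x hx).trans (key y hy).symm
  · intro v _
    obtain ⟨c, hcB, hcC, hcv⟩ : ∃ c, c ∈ B ∧ c ∈ C ∧ c ≠ v := by
      by_cases h : a = v
      · exact ⟨b, hbB, hbC, fun h' => hab (h.trans h'.symm)⟩
      · exact ⟨a, haB, haC, h⟩
    have key : ∀ x ∈ (B ∪ C) \ {v}, Rch G ((B ∪ C) \ {v}) x c := by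
      rintro x ⟨hx | hx, hxv⟩
      · exact (gen B hB.2.1 hB.2.2 v x ⟨hx, hxv⟩ c ⟨hcB, hcv⟩).mono
          (Set.diff_subset_diff_left Set.subset_union_left)
      · exact (gen C hC.2.1 hC.2.2 v x ⟨hx, hxv⟩ c ⟨hcC, hcv⟩).mono
          (Set.diff_subset_diff_left Set.subset_union_right)
    exact fun x hx y hy => (key x hx).trans (key y hy).symm

theorem IsBlock.eq_of_two {G : SimpleGraph V} {B C : Set V} (hB : IsBlock G B)
    (hC : IsBlock G C) {a b : V} (hab : a ≠ b) (haB : a ∈ B) (hbB : b ∈ B) (haC : a ∈ C)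
    (hbC : b ∈ C) : B = C := by
  have h := blockPred_union hB.1 hC.1 hab haB hbB haC hbC
  exact (hB.2 _ Set.subset_union_left h).symm.trans (hC.2 _ Set.subset_union_right h)

theorem Rch.exists_path {G : SimpleGraph V} {S : Set V} {a b : V} (h : Rch G S a b) :
    ∃ p : G.Walk a b, p.IsPath ∧ ∀ x ∈ p.support, x ∈ S := by
  classical
  obtain ⟨p, hp⟩ := h
  exact ⟨p.bypass, p.bypass_isPath, fun x hx => hp x (p.support_bypass_subset hx)⟩

/-- A vertex outside `H` in the block, together with a vertex of the block in `H`. -/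
theorem step_one {G : SimpleGraph V} {B H : Set V} (hB : IsBlock G B)
    (hH : ∀ a ∈ H, ∀ b ∈ H, Rch G H a b) {w b x : V} (hwB : w ∈ B) (hw : w ∉ H) (hbB : b ∈ B)
    (hb : b ∈ H) (hx : x ∈ H) (hwx : G.Adj w x) : x ∈ B := by
  obtain ⟨p, hp, hpH⟩ := (hH x hx b hb).exists_path
  have hq : (Walk.cons hwx p).IsPath := by
    rw [Walk.cons_isPath_iff]
    exact ⟨hp, fun h => hw (hpH _ h)⟩
  exact hB.path_mem hwB hbB (fun h => hw (h ▸ hb)) _ hq (by simp)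

theorem step_two {G : SimpleGraph V} {B H : Set V} (hB : IsBlock G B)
    (hH : ∀ a ∈ H, ∀ b ∈ H, Rch G H a b) {w z x y : V} (hwz : w ≠ z) (hwB : w ∈ B) (hw : w ∉ H)
    (hzB : z ∈ B) (hz : z ∉ H) (hx : x ∈ H) (hwx : G.Adj w x)
    (hy : y ∈ H) (hzy : G.Adj z y) : x ∈ B ∧ y ∈ B := by
  obtain ⟨p, hp, hpH⟩ := (hH x hx y hy).exists_path
  have hq : (Walk.cons hzy p.reverse).IsPath := by
    rw [Walk.cons_isPath_iff]
    refine ⟨hp.reverse, fun h => hz (hpH _ (by simpa using h))⟩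
  have hq2 : (Walk.cons hwx (Walk.cons hzy p.reverse).reverse).IsPath := by
    rw [Walk.cons_isPath_iff]
    refine ⟨hq.reverse, fun h => ?_⟩
    rw [Walk.support_reverse, List.mem_reverse, Walk.support_cons, List.mem_cons] at h
    rcases h with h | h
    · exact hwz h
    · exact hw (hpH _ (by simpa using h))
  exact ⟨hB.path_mem hwB hzB hwz _ hq2 (by simp), hB.path_mem hwB hzB hwz _ hq2 (by simp)⟩

theorem step_all {G : SimpleGraph V} {B H H' : Set V} (hB : IsBlock G B)
    (hH : ∀ a ∈ H, ∀ b ∈ H, Rch G H a b)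
    (hH' : ∀ w ∈ H', w ∈ H ∨ ∃ x ∈ H, ∃ y ∈ H, x ≠ y ∧ G.Adj w x ∧ G.Adj w y)
    (h : ∃ w ∈ H', ∃ z ∈ H', w ≠ z ∧ w ∈ B ∧ z ∈ B) :
    ∃ w ∈ H, ∃ z ∈ H, w ≠ z ∧ w ∈ B ∧ z ∈ B := by
  have one : ∀ w ∈ H', ∀ z ∈ H, w ∉ H → w ∈ B → z ∈ B →
      ∃ w ∈ H, ∃ z ∈ H, w ≠ z ∧ w ∈ B ∧ z ∈ B := by
    intro w hw z hz hwH hwB hzB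
    obtain ⟨x, hx, y, hy, hxy, hwx, hwy⟩ := (hH' w hw).resolve_left hwH
    exact ⟨x, hx, y, hy, hxy, step_one hB hH hwB hwH hzB hz hx hwx,
      step_one hB hH hwB hwH hzB hz hy hwy⟩
  obtain ⟨w, hw, z, hz, hwz, hwB, hzB⟩ := h
  by_cases hwH : w ∈ H
  · by_cases hzH : z ∈ H
    · exact ⟨w, hwH, z, hzH, hwz, hwB, hzB⟩
    · exact one z hz w hwH hzH hzB hwB
  · by_cases hzH : z ∈ H
    · exact one w hw z hzH hwH hwB hzB
    · obtain ⟨x, hx, y, hy, hxy, hwx, hwy⟩ := (hH' w hw).resolve_left hwH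
      obtain ⟨u, hu, _, _, _, hzu, _⟩ := (hH' z hz).resolve_left hzH
      exact ⟨x, hx, y, hy, hxy, (step_two hB hH hwz hwB hwH hzB hzH hx hwx hu hzu).1,
        (step_two hB hH hwz hwB hwH hzB hzH hy hwy hu hzu).1⟩

theorem block_two {G : SimpleGraph V} [Nontrivial V] (hG : G.Connected) {B : Set V}
    (hB : IsBlock G B) : ∃ w z, w ≠ z ∧ w ∈ B ∧ z ∈ B := by
  obtain ⟨x, hx⟩ := (blockPred_iff.1 hB.1).1
  by_contra hcon
  push Not at hcon
  obtain ⟨y, hxy⟩ := hG.preconnected.exists_adj_of_nontrivial x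
  have hsub : B ⊆ {x, y} := fun z hz => by
    by_cases h : z = x
    · exact Or.inl h
    · exact absurd hx (hcon z x h hz)
  have hP : BlockPred G {x, y} := by
    have hx' : x ∈ ({x, y} : Set V) := Or.inl rfl
    have hy' : y ∈ ({x, y} : Set V) := Or.inr rfl
    rw [blockPred_iff]
    refine ⟨⟨x, hx'⟩, ?_, ?_⟩
    · rintro a (rfl | rfl) b (rfl | rfl)
      · exact Rch.refl hx'
      · exact Rch.adj hxy hx' hy'
      · exact Rch.adj hxy.symm hy' hx'
      · exact Rch.refl hy'
    · rintro v hv a ha b hb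
      have : a = b := by
        have := hxy.ne
        simp only [Set.mem_diff, Set.mem_insert_iff, Set.mem_singleton_iff] at *
        grind
      subst this
      exact Rch.refl ha
  have := hB.2 _ hsub hP
  have hy : y ∈ B := by rw [← this]; exact Or.inr rfl
  exact hcon x y hxy.ne hx hy

/-- For `r ≥ 2`, an `r`-bootstrap good connected graph with at least `r + 1`
vertices contains at most `r` blocks. -/
theorem stmt_10 {V : Type*} [Fintype V] (G : SimpleGraph V) (r : ℕ) (hr : 2 ≤ r)
    (hconn : G.Connected) (hcard : r + 1 ≤ Fintype.card V)
    (hBG : BootstrapGood G r) :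
    {B : Set V | IsBlock G B}.ncard ≤ r := by
  classical
  obtain ⟨A, hA, t, ht⟩ := hBG
  haveI : Nontrivial V := Fintype.one_lt_card_iff_nontrivial.1 (by omega)
  -- a first infected vertex
  obtain ⟨v, hvA, hv⟩ : ∃ v, v ∉ A ∧ ∀ a ∈ A, G.Adj v a := by
    by_contra hcon
    push Not at hcon
    have hst : percStep G r A = A := by
      refine Set.Subset.antisymm ?_ Set.subset_union_left
      rintro w (hw | hw)
      · exact hw
      · by_contra hwA
        obtain ⟨a, ha, hwa⟩ := hcon w hwA
        have : G.neighborSet w ∩ A = A :=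
          Set.eq_of_subset_of_ncard_le Set.inter_subset_right (by rw [hA]; exact hw)
            (Set.toFinite A)
        rw [← this] at ha
        exact hwa ha.1
    have hall : ∀ s, percIter G r A s = A := by
      intro s
      induction s with
      | zero => rfl
      | succ s ih => rw [percIter, ih, hst]
    rw [hall t] at ht
    rw [ht, Set.ncard_univ, Nat.card_eq_fintype_card] at hA
    omega
  have inv : ∀ s, (∀ a ∈ insert v (percIter G r A s), Rch G (insert v (percIter G r A s)) a v) ∧
      ∀ B, IsBlock G B → (∃ w ∈ insert v (percIter G r A s), ∃ z ∈ insert v (percIter G r A s),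
        w ≠ z ∧ w ∈ B ∧ z ∈ B) → ∃ w ∈ insert v A, ∃ z ∈ insert v A, w ≠ z ∧ w ∈ B ∧ z ∈ B := by
    intro s
    induction s with
    | zero =>
      refine ⟨?_, fun B _ h => h⟩
      rintro a (rfl | ha)
      · exact Rch.refl (Or.inl rfl)
      · exact Rch.adj (hv a ha).symm (Or.inr ha) (Or.inl rfl)
    | succ s ih =>
      obtain ⟨ih1, ih2⟩ := ih
      have hsub : insert v (percIter G r A s) ⊆ insert v (percIter G r A (s + 1)) :=
        Set.insert_subset_insert Set.subset_union_left
      have hst : ∀ w ∈ insert v (percIter G r A (s + 1)), w ∈ insert v (percIter G r A s) ∨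
          ∃ x ∈ insert v (percIter G r A s), ∃ y ∈ insert v (percIter G r A s),
            x ≠ y ∧ G.Adj w x ∧ G.Adj w y := by
        rintro w (hw | hw | hw)
        · exact Or.inl (Or.inl hw)
        · exact Or.inl (Or.inr hw)
        · right
          have h2 : 1 < (G.neighborSet w ∩ percIter G r A s).ncard := lt_of_lt_of_le hr hw
          obtain ⟨x, y, hx, hy, hxy⟩ := (Set.one_lt_ncard_iff (Set.toFinite _)).1 h2
          exact ⟨x, Or.inr hx.2, y, Or.inr hy.2, hxy, hx.1, hy.1⟩
      refine ⟨?_, fun B hB h => ih2 B hB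
        (step_all hB (fun a ha b hb => (ih1 a ha).trans (ih1 b hb).symm) hst h)⟩
      intro a ha
      rcases hst a ha with h | ⟨x, hx, _, _, _, hax, _⟩
      · exact (ih1 a h).mono hsub
      · exact (Rch.adj hax ha (hsub hx)).trans ((ih1 x hx).mono hsub)
  have main : ∀ B, IsBlock G B → ∃ a ∈ A, a ∈ B ∧ v ∈ B := by
    intro B hB
    obtain ⟨w, z, hwz, hwB, hzB⟩ := block_two hconn hB
    obtain ⟨w, hw, z, hz, hwz, hwB, hzB⟩ := (inv t).2 B hB
      ⟨w, by simp [ht], z, by simp [ht], hwz, hwB, hzB⟩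
    rcases hw with rfl | hw
    · rcases hz with rfl | hz
      · exact absurd rfl hwz
      · exact ⟨z, hz, hzB, hwB⟩
    · rcases hz with rfl | hz
      · exact ⟨w, hw, hwB, hzB⟩
      · refine ⟨w, hw, hwB, ?_⟩
        have hp : (Walk.cons (hv w hw).symm (Walk.cons (hv z hz) Walk.nil)).IsPath := by
          simp [Walk.cons_isPath_iff, hwz, (hv w hw).ne', (hv z hz).ne]
        exact hB.path_mem hwB hzB hwz _ hp (by simp)
  choose! f hf using main
  rw [← hA]
  refine Set.ncard_le_ncard_of_injOn f (fun B hB => (hf B hB).1) ?_ (Set.toFinite A)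
  intro B hB C hC hBC
  have h1 := hf B hB
  have h2 := hf C hC
  exact hB.eq_of_two hC (a := f B) (b := v) (fun h => hvA (h ▸ h1.1)) h1.2.1 h1.2.2
    (hBC ▸ h2.2.1) h2.2.2
end

section
/- Let r ≥ 3 and let G be a finite connected simple graph with at least r + 1 vertices that is r-bootstrap good. If G has exactly r blocks, then G is isomorphic to the star K_{1,r}. -/
open SimpleGraph

variable {V : Type*}

/-- The induced subgraph is preconnected. -/
def Pre (G : SimpleGraph V) (S : Set V) : Prop := (G.induce S).Preconnected

lemma pre_subsingleton (G : SimpleGraph V) {S : Set V} (h : S.Subsingleton) : Pre G S := by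
  intro a b
  have : a = b := Subtype.ext (h a.2 b.2)
  rw [this]

lemma pre_union {G : SimpleGraph V} {S T : Set V} (hS : Pre G S) (hT : Pre G T)
    {x : V} (hxS : x ∈ S) (hxT : x ∈ T) : Pre G (S ∪ T) := by
  exact (induce_union_connected hS hT ⟨x, hxS, hxT⟩).preconnected

lemma pre_pair {G : SimpleGraph V} {u v : V} (h : G.Adj u v) : Pre G {u, v} :=
  (induce_pair_connected_of_adj h).preconnected

lemma pre_insert {G : SimpleGraph V} {S : Set V} (hS : Pre G S) {u w : V} (hu : u ∈ S)
    (h : G.Adj w u) : Pre G (insert w S) := by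
  have h1 := pre_union hS (pre_pair h) hu (by simp)
  have : S ∪ {w, u} = insert w S := by
    ext y; simp only [Set.mem_union, Set.mem_insert_iff, Set.mem_singleton_iff]
    constructor
    · rintro (h | h | rfl) <;> simp_all
    · rintro (h | h) <;> simp_all
  rwa [this] at h1

lemma bp_iff (G : SimpleGraph V) (B : Set V) :
    BlockPred G B ↔ B.Nonempty ∧ Pre G B ∧ ∀ v, Pre G (B \ {v}) := by
  constructor
  · rintro ⟨h1, h2⟩
    refine ⟨?_, h1.preconnected, fun v => ?_⟩
    · obtain ⟨x⟩ := h1.nonempty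
      exact ⟨x.1, x.2⟩
    · by_cases hv : v ∈ B
      · exact h2 v hv
      · rw [Set.sdiff_singleton_eq_self hv]; exact h1.preconnected
  · rintro ⟨⟨x, hx⟩, h1, h2⟩
    haveI : Nonempty B := ⟨⟨x, hx⟩⟩
    exact ⟨Connected.mk h1, fun v _ => h2 v⟩

lemma bp_union {G : SimpleGraph V} {S T : Set V} (hS : BlockPred G S) (hT : BlockPred G T)
    {p q : V} (hpq : p ≠ q) (hp : p ∈ S) (hp' : p ∈ T) (hq : q ∈ S) (hq' : q ∈ T) :
    BlockPred G (S ∪ T) := by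
  rw [bp_iff] at *
  obtain ⟨-, a1, a2⟩ := hS
  obtain ⟨-, b1, b2⟩ := hT
  refine ⟨⟨p, Or.inl hp⟩, pre_union a1 b1 hp hp', fun v => ?_⟩
  rw [Set.union_sdiff_distrib]
  by_cases hv : p = v
  · have : q ≠ v := hv ▸ hpq.symm
    exact pre_union (a2 v) (b2 v) (x := q) ⟨hq, this⟩ ⟨hq', this⟩
  · exact pre_union (a2 v) (b2 v) (x := p) ⟨hp, hv⟩ ⟨hp', hv⟩

lemma bp_pair {G : SimpleGraph V} {u v : V} (h : G.Adj u v) : BlockPred G {u, v} := by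
  rw [bp_iff]
  refine ⟨⟨u, by simp⟩, pre_pair h, fun x => ?_⟩
  by_cases hx : x ∈ ({u, v} : Set V)
  · apply pre_subsingleton
    intro a ha b hb
    simp only [Set.mem_sdiff, Set.mem_insert_iff, Set.mem_singleton_iff] at *
    grind
  · rw [Set.sdiff_singleton_eq_self hx]; exact pre_pair h

lemma insert_diff_ne {S : Set V} {w x : V} (h : w ≠ x) :
    insert w S \ {x} = insert w (S \ {x}) := by
  ext y
  simp only [Set.mem_sdiff, Set.mem_insert_iff, Set.mem_singleton_iff]
  grind

lemma insert_diff_same {S : Set V} {w : V} : insert w S \ {w} = S \ {w} := by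
  ext y
  simp only [Set.mem_sdiff, Set.mem_insert_iff, Set.mem_singleton_iff]
  grind

lemma bp_insert {G : SimpleGraph V} {S : Set V} (hS : BlockPred G S) {u u' w : V}
    (hne : u ≠ u') (hu : u ∈ S) (hu' : u' ∈ S) (h : G.Adj w u) (h' : G.Adj w u') :
    BlockPred G (insert w S) := by
  rw [bp_iff] at *
  obtain ⟨-, a1, a2⟩ := hS
  refine ⟨⟨u, Or.inr hu⟩, pre_insert a1 hu h, fun x => ?_⟩
  by_cases hx : w = x
  · subst hx; rw [insert_diff_same]; exact a2 _
  · rw [insert_diff_ne hx]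
    by_cases hux : u = x
    · exact pre_insert (a2 x) (u := u') ⟨hu', fun e => hne (hux.trans (Eq.symm e))⟩ h'
    · exact pre_insert (a2 x) (u := u) ⟨hu, hux⟩ h

lemma bp_insert_union {G : SimpleGraph V} {S T : Set V} (hS : BlockPred G S)
    (hT : BlockPred G T) {c u u' w : V} (hcS : c ∈ S) (hcT : c ∈ T) (huc : u ≠ c) (huc' : u' ≠ c)
    (hwc : w ≠ c) (hne : u ≠ u') (hu : u ∈ S) (hu' : u' ∈ T)
    (h : G.Adj w u) (h' : G.Adj w u') :
    BlockPred G (insert w (S ∪ T)) := by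
  rw [bp_iff] at *
  obtain ⟨-, a1, a2⟩ := hS
  obtain ⟨-, b1, b2⟩ := hT
  have key : ∀ x, x ≠ c → Pre G ((S ∪ T) \ {x}) := fun x hx => by
    rw [Set.union_sdiff_distrib]
    exact pre_union (a2 x) (b2 x) (x := c) ⟨hcS, hx.symm⟩ ⟨hcT, hx.symm⟩
  refine ⟨⟨w, Or.inl rfl⟩, pre_insert (pre_union a1 b1 hcS hcT) (Or.inl hu) h, fun x => ?_⟩
  by_cases hx : w = x
  · subst hx; rw [insert_diff_same]; exact key _ hwc
  · rw [insert_diff_ne hx]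
    by_cases hxc : x = c
    · have h1 := pre_insert (a2 x) (u := u) ⟨hu, hxc ▸ huc⟩ h
      have h2 := pre_insert (b2 x) (u := u') ⟨hu', hxc ▸ huc'⟩ h'
      have h3 := pre_union h1 h2 (Set.mem_insert _ _) (Set.mem_insert _ _)
      rwa [← Set.insert_union_distrib, ← Set.union_sdiff_distrib] at h3
    · by_cases hux : u = x
      · exact pre_insert (key x hxc) (u := u')
          ⟨Or.inr hu', fun e => hne (hux.trans (Eq.symm e))⟩ h'
      · exact pre_insert (key x hxc) (u := u) ⟨Or.inl hu, hux⟩ h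

lemma exists_next [Finite V] {G : SimpleGraph V} {r : ℕ} {A : Set V} (hp : Percolates G r A)
    {C : Set V} (hAC : A ⊆ C) (hC : C ≠ Set.univ) :
    ∃ w, w ∉ C ∧ r ≤ (G.neighborSet w ∩ C).ncard := by
  by_contra! hcon
  obtain ⟨t, ht⟩ := hp
  apply hC
  have : ∀ t, percIter G r A t ⊆ C := by
    intro t
    induction t with
    | zero => exact hAC
    | succ t ih =>
      rintro v (hv | hv)
      · exact ih hv
      · by_contra hvC
        have h1 := hcon v hvC
        have h2 : (G.neighborSet v ∩ percIter G r A t).ncard ≤ (G.neighborSet v ∩ C).ncard :=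
          Set.ncard_le_ncard (Set.inter_subset_inter_right _ ih) (Set.toFinite _)
        have h3 : r ≤ (G.neighborSet v ∩ percIter G r A t).ncard := hv
        omega
  exact Set.univ_subset_iff.mp (ht ▸ this t)

lemma exists_block_s11 [Finite V] {G : SimpleGraph V} {S : Set V} (hS : BlockPred G S) :
    ∃ B, S ⊆ B ∧ IsBlock G B := by
  obtain ⟨B, hB, hmax⟩ := (Set.toFinite {B | BlockPred G B}).exists_le_maximal hS
  exact ⟨B, hB, hmax.1, fun B' h h' => (hmax.2 h' h).antisymm h⟩

/-- The invariant: `u, v` lie in a common cut-vertex-free set meeting `A` and containing `c`. -/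
def Together (G : SimpleGraph V) (A : Set V) (c u v : V) : Prop :=
  ∃ S, BlockPred G S ∧ u ∈ S ∧ v ∈ S ∧ c ∈ S ∧ ∃ a ∈ A, a ∈ S

lemma all_together [Finite V] {G : SimpleGraph V} {r : ℕ} (hr : 2 ≤ r) {A : Set V}
    (hp : Percolates G r A) {c : V} (hc : ∀ a ∈ A, G.Adj c a) (hA : A.Nonempty) :
    ∀ u v, G.Adj u v → Together G A c u v := by
  let P : Set V → Prop := fun H => insert c A ⊆ H ∧ (∀ u ∈ H, Together G A c u u) ∧
    ∀ u ∈ H, ∀ v ∈ H, G.Adj u v → Together G A c u v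
  have base : P (insert c A) := by
    have hca : ∀ a ∈ A, Together G A c c a := fun a ha =>
      ⟨{c, a}, bp_pair (hc a ha), by simp, by simp, by simp, a, ha, by simp⟩
    refine ⟨subset_rfl, ?_, ?_⟩
    · rintro u (rfl | hu)
      · obtain ⟨a, ha⟩ := hA
        obtain ⟨S, h1, h2, h3, h4⟩ := hca a ha
        exact ⟨S, h1, h2, h2, h4⟩
      · obtain ⟨S, h1, h2, h3, h4⟩ := hca u hu
        exact ⟨S, h1, h3, h3, h4⟩
    · rintro u (rfl | hu) v (rfl | hv) huv
      · exact absurd huv (G.irrefl)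
      · exact hca v hv
      · obtain ⟨S, h1, h2, h3, h4⟩ := hca u hu
        exact ⟨S, h1, h3, h2, h4⟩
      · refine ⟨insert v {c, u}, bp_insert (bp_pair (hc u hu)) (hc u hu).ne (by simp) (by simp)
          (hc v hv).symm huv.symm, by simp, by simp, by simp, u, hu, by simp⟩
  obtain ⟨H, -, hmax⟩ := (Set.toFinite {H | P H}).exists_le_maximal base
  obtain ⟨hH1, hH2, hH3⟩ := hmax.1
  have hcH : c ∈ H := hH1 (by simp)
  suffices H = Set.univ by
    intro u v huv
    exact hH3 u (this ▸ trivial) v (this ▸ trivial) huv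
  by_contra hne
  obtain ⟨w, hw, hwr⟩ := exists_next hp ((Set.subset_insert c A).trans hH1) hne
  have hwc : w ≠ c := fun h => hw (h ▸ hcH)
  have new : ∀ u ∈ H, G.Adj w u → Together G A c w u := by
    intro u hu hwu
    obtain ⟨u', ⟨hwu', hu'⟩, hne'⟩ := Set.exists_ne_of_one_lt_ncard (by omega) u
      (s := G.neighborSet w ∩ H)
    have hwu' : G.Adj w u' := hwu'
    obtain ⟨S, h1, h2, -, h4, a, ha, haS⟩ := hH2 u hu
    obtain ⟨T, k1, k2, -, k4, b, hb, hbT⟩ := hH2 u' hu'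
    by_cases huc : u = c
    · subst huc
      exact ⟨insert w T, bp_insert k1 hne'.symm k4 k2 hwu hwu', by simp, by simp [k4],
        by simp [k4], b, hb, by simp [hbT]⟩
    by_cases huc' : u' = c
    · subst huc'
      exact ⟨insert w S, bp_insert h1 hne'.symm h2 h4 hwu hwu', by simp, by simp [h2],
        by simp [h4], a, ha, by simp [haS]⟩
    exact ⟨insert w (S ∪ T), bp_insert_union h1 k1 h4 k4 huc huc' hwc hne'.symm h2 k2 hwu hwu',
      by simp, by simp [h2], by simp [h4], a, ha, by simp [haS]⟩
  have neww : Together G A c w w := by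
    obtain ⟨u, hu1, hu2⟩ : (G.neighborSet w ∩ H).Nonempty := by
      apply Set.nonempty_of_ncard_ne_zero; omega
    obtain ⟨S, h1, h2, h3, h4⟩ := new u hu2 hu1
    exact ⟨S, h1, h2, h2, h4⟩
  have hP : P (insert w H) := by
    refine ⟨hH1.trans (Set.subset_insert _ _), ?_, ?_⟩
    · rintro u (rfl | hu)
      · exact neww
      · exact hH2 u hu
    · rintro u (rfl | hu) v (rfl | hv) huv
      · exact neww
      · exact new v hv huv
      · obtain ⟨S, h1, h2, h3, h4⟩ := new u hu huv.symm
        exact ⟨S, h1, h3, h2, h4⟩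
      · exact hH3 u hu v hv huv
  exact hw (hmax.2 hP (Set.subset_insert w H) (Set.mem_insert w H))

theorem stmt_11 {V : Type*} [Fintype V] (G : SimpleGraph V) (r : ℕ) (hr : 3 ≤ r)
    (hconn : G.Connected) (hcard : r + 1 ≤ Fintype.card V)
    (hBG : BootstrapGood G r)
    (hblocks : {B : Set V | IsBlock G B}.ncard = r) :
    Nonempty (G ≃g completeBipartiteGraph (Fin 1) (Fin r)) := by
  obtain ⟨A, hAr, hp⟩ := hBG
  have hAne : A ≠ Set.univ := by
    rintro rfl
    rw [Set.ncard_univ, Nat.card_eq_fintype_card] at hAr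
    omega
  have hA0 : A.Nonempty := by
    apply Set.nonempty_of_ncard_ne_zero; omega
  obtain ⟨c, hcA, hcr⟩ := exists_next hp subset_rfl hAne
  have hc : ∀ a ∈ A, G.Adj c a := by
    have : G.neighborSet c ∩ A = A :=
      Set.eq_of_subset_of_ncard_le Set.inter_subset_right (by omega) (Set.toFinite _)
    intro a ha
    rw [← this] at ha
    exact ha.1
  have htog := all_together (by omega) hp hc hA0
  -- every block contains `c` and some `a ∈ A`
  have hblk : ∀ B, IsBlock G B → c ∈ B ∧ ∃ a ∈ A, a ∈ B := by
    intro B hB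
    have hedge : ∃ u ∈ B, ∃ v ∈ B, G.Adj u v := by
      have hcon := hB.1.1
      obtain ⟨⟨x, hx⟩⟩ := hcon.nonempty
      have hnt : Nontrivial V := by
        rw [← Fintype.one_lt_card_iff_nontrivial]; omega
      by_cases hs : ∃ y ∈ B, y ≠ x
      · obtain ⟨y, hy, hyx⟩ := hs
        have : Nontrivial B := ⟨⟨⟨y, hy⟩, ⟨x, hx⟩, fun h => hyx (congrArg Subtype.val h)⟩⟩
        obtain ⟨z, hz⟩ := hcon.preconnected.exists_adj_of_nontrivial ⟨x, hx⟩
        exact ⟨x, hx, z, z.2, hz⟩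
      · push Not at hs
        obtain ⟨z, hz⟩ := hconn.preconnected.exists_adj_of_nontrivial x
        have := hB.2 {x, z} (fun y hy => by simp [hs y hy]) (bp_pair hz)
        exact ⟨x, hx, z, by rw [← this]; simp, hz⟩
    obtain ⟨u, hu, v, hv, huv⟩ := hedge
    obtain ⟨S, h1, h2, h3, h4, a, ha, haS⟩ := htog u v huv
    have := hB.2 (B ∪ S) Set.subset_union_left (bp_union hB.1 h1 huv.ne hu h2 hv h3)
    rw [← this]
    exact ⟨Or.inr h4, a, ha, Or.inr haS⟩
  have huniq : ∀ B B' a, IsBlock G B → IsBlock G B' → a ∈ A → a ∈ B → a ∈ B' → B = B' := by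
    intro B B' a hB hB' ha h h'
    have hU := bp_union hB.1 hB'.1 (hc a ha).ne (hblk B hB).1 (hblk B' hB').1 h h'
    exact (hB.2 _ Set.subset_union_left hU).symm.trans (hB'.2 _ Set.subset_union_right hU)
  haveI : Nonempty V := ⟨c⟩
  have hblk2 : ∀ B, IsBlock G B → ∃ a, a ∈ A ∧ a ∈ B := fun B hB => (hblk B hB).2
  choose! f hfA hfB using hblk2
  have himg : f '' {B | IsBlock G B} = A := by
    apply Set.eq_of_subset_of_ncard_le _ _ (Set.toFinite _)
    · rintro _ ⟨B, hB, rfl⟩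
      exact hfA B hB
    · rw [Set.ncard_image_of_injOn, hblocks, hAr]
      intro B hB B' hB' h
      exact huniq B B' (f B) hB hB' (hfA B hB) (hfB B hB) (h ▸ hfB B' hB')
  have hno : ∀ S a a', BlockPred G S → c ∈ S → a ∈ A → a' ∈ A → a ∈ S → a' ∈ S → a = a' := by
    intro S a a' hS hcS ha ha' haS haS'
    obtain ⟨B, hSB, hB⟩ := exists_block_s11 hS
    have key : ∀ x ∈ A, x ∈ S → f B = x := by
      intro x hx hxS
      obtain ⟨C, hC, rfl⟩ := himg.symm ▸ hx
      rw [huniq B C (f C) hB hC hx (hSB hxS) (hfB C hC)]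
    exact (key a ha haS).symm.trans (key a' ha' haS')
  have hind : ∀ a ∈ A, ∀ a' ∈ A, ¬ G.Adj a a' := by
    intro a ha a' ha' h
    refine h.ne (hno (insert a' {c, a}) a a' (bp_insert (bp_pair (hc a ha)) (hc a ha).ne
      (by simp) (by simp) (hc a' ha').symm h.symm) (by simp) ha ha' (by simp) (by simp))
  have huniv : insert c A = Set.univ := by
    by_contra hne
    obtain ⟨w, hw, hwr⟩ := exists_next hp (Set.subset_insert c A) hne
    have hwc : w ≠ c := fun h => hw (by simp [h])
    have h2 : 1 < (G.neighborSet w ∩ A).ncard := by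
      have : G.neighborSet w ∩ insert c A ⊆ insert c (G.neighborSet w ∩ A) := by
        rintro x ⟨h1, rfl | h2⟩
        · simp
        · exact Or.inr ⟨h1, h2⟩
      have h3 := Set.ncard_le_ncard this (Set.toFinite _)
      have h4 := Set.ncard_insert_le c (G.neighborSet w ∩ A)
      omega
    obtain ⟨a, ⟨hwa, ha⟩, a', ⟨hwa', ha'⟩, hne'⟩ := (Set.one_lt_ncard (Set.toFinite _)).mp h2
    exact hne' (hno _ a a' (bp_insert_union (bp_pair (hc a ha)) (bp_pair (hc a' ha')) (c := c)
      (u := a) (u' := a') (w := w) (by simp) (by simp) (hc a ha).ne' (hc a' ha').ne' hwc hne'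
      (by simp) (by simp) hwa hwa') (by simp) ha ha' (by simp) (by simp))
  have hcA' : Nat.card A = r := hAr
  let e : Fin r ≃ A := (Finite.equivFinOfCardEq hcA').symm
  let g : Fin 1 ⊕ Fin r → V := Sum.elim (fun _ => c) (fun i => (e i : V))
  have hg : Function.Bijective g := by
    constructor
    · rintro (i | i) (j | j) h
      · rw [Subsingleton.elim i j]
      · exact absurd (show (e j : V) = c from h.symm) (fun h => hcA (h ▸ (e j).2))
      · exact absurd (show (e i : V) = c from h) (fun h => hcA (h ▸ (e i).2))
      · exact congrArg _ (e.injective (Subtype.ext h))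
    · intro x
      rcases (huniv.symm ▸ Set.mem_univ x : x ∈ insert c A) with rfl | hx
      · exact ⟨Sum.inl 0, rfl⟩
      · exact ⟨Sum.inr (e.symm ⟨x, hx⟩), by simp [g]⟩
  refine ⟨RelIso.symm ⟨Equiv.ofBijective g hg, ?_⟩⟩
  rintro (i | i) (j | j)
  · simp [g]
  · simp [g, hc _ (e j).2]
  · simp [g, (hc _ (e i).2).symm]
  · simp [g, hind _ (e i).2 _ (e j).2]
end

section
/- Let G be a finite connected simple graph with at least r + 1 vertices, let A₀ be a percolating set of G of cardinality r under r-bootstrap percolation, and let X be a cut set of G with |X| < r. Then there is no cut set Y of G with |Y| < r and Y ∩ X = ∅. -/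
open SimpleGraph

variable {V : Type*}

theorem aux_part [Fintype V] (G : SimpleGraph V) (r : ℕ) (A : Set V)
    (X P : Set V) (hX : X.ncard < r) (hP : ∀ v ∈ P, ∀ u, G.Adj v u → u ∈ P ∨ u ∈ X)
    (hA : ∀ u ∈ A, u ∉ P) (t : ℕ) : ∀ u ∈ percIter G r A t, u ∉ P := by
  induction t with
  | zero => exact hA
  | succ t ih =>
    intro u hu huP
    rcases hu with hu | hu
    · exact ih u hu huP
    · have hsub : G.neighborSet u ∩ percIter G r A t ⊆ X := by
        rintro w ⟨hw, hw2⟩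
        rcases hP u huP w hw with h | h
        · exact absurd h (ih w hw2)
        · exact h
      have h1 := Set.ncard_le_ncard hsub (Set.toFinite X)
      have h2 : r ≤ (G.neighborSet u ∩ percIter G r A t).ncard := hu
      omega

theorem aux_mem [Fintype V] (G : SimpleGraph V) (r : ℕ) (A : Set V)
    (hperc : Percolates G r A) (X : Set V) (hX : IsCutSet G X) (hXcard : X.ncard < r)
    (v : V) (hv : A ⊆ G.neighborSet v) : v ∈ X := by
  by_contra hvX
  apply hX
  rw [SimpleGraph.connected_iff_exists_forall_reachable]
  refine ⟨⟨v, hvX⟩, ?_⟩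
  by_contra hcon
  push Not at hcon
  obtain ⟨w, hw⟩ := hcon
  obtain ⟨t, ht⟩ := hperc
  let P : Set V := {u | ∃ h : u ∉ X, ¬ (G.induce {v | v ∉ X}).Reachable ⟨v, hvX⟩ ⟨u, h⟩}
  refine aux_part G r A X P hXcard ?_ ?_ t w.1 (ht ▸ Set.mem_univ _) ⟨w.2, hw⟩
  · rintro a ⟨ha, har⟩ u hu
    by_cases huX : u ∈ X
    · exact Or.inr huX
    · refine Or.inl ⟨huX, fun hr => har (hr.trans ?_)⟩
      apply SimpleGraph.Adj.reachable
      exact hu.symm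
  · rintro u hu ⟨huX, hur⟩
    apply hur
    apply SimpleGraph.Adj.reachable
    exact hv hu

theorem aux_first [Fintype V] (G : SimpleGraph V) (r : ℕ) (A : Set V)
    (hcard : r + 1 ≤ Fintype.card V) (hA : A.ncard = r) (hperc : Percolates G r A) :
    ∃ v, A ⊆ G.neighborSet v := by
  by_contra hcon
  push Not at hcon
  have hall : ∀ t, percIter G r A t = A := by
    intro t
    induction t with
    | zero => rfl
    | succ t ih =>
      change percStep G r (percIter G r A t) = A
      rw [ih]
      refine Set.union_eq_self_of_subset_right ?_
      intro v hv
      have hv' : r ≤ (G.neighborSet v ∩ A).ncard := hv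
      have := Set.eq_of_subset_of_ncard_le (Set.inter_subset_right : G.neighborSet v ∩ A ⊆ A)
        (by omega) (Set.toFinite A)
      exact absurd (Set.inter_eq_right.mp this) (hcon v)
  obtain ⟨t, ht⟩ := hperc
  rw [hall t] at ht
  rw [ht, Set.ncard_univ, Nat.card_eq_fintype_card] at hA
  omega

/-- If `X` is a cut set of size less than `r` in a graph with a percolating set of
cardinality `r`, there is no cut set `Y` with `|Y| < r` disjoint from `X`. -/
theorem stmt_12 {V : Type*} [Fintype V] (G : SimpleGraph V) (r : ℕ)
    (hconn : G.Connected) (hcard : r + 1 ≤ Fintype.card V)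
    (A₀ : Set V) (hA₀ : A₀.ncard = r) (hperc : Percolates G r A₀)
    (X : Set V) (hX : IsCutSet G X) (hXcard : X.ncard < r) :
    ¬ ∃ Y : Set V, Y.ncard < r ∧ Y ∩ X = ∅ ∧ IsCutSet G Y := by
  rintro ⟨Y, hYcard, hYX, hY⟩
  obtain ⟨v, hv⟩ := aux_first G r A₀ hcard hA₀ hperc
  have h : v ∈ Y ∩ X := ⟨aux_mem G r A₀ hperc Y hY hYcard v hv,
    aux_mem G r A₀ hperc X hX hXcard v hv⟩
  rw [hYX] at h
  exact h
end

section
/- For every r ≥ 2 there exists a finite connected simple graph G with at least r + 1 vertices such that G is r-bootstrap good, G has a cut set of size less than r, and G contains at least r(r − 1) distinct r-blocks. -/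
open SimpleGraph

variable {V : Type*}

/-- `B` induces a `k`-connected subgraph: it has at least `k + 1` vertices and no
cut set of size at most `k - 1`. -/
def KConnSet (G : SimpleGraph V) (k : ℕ) (B : Set V) : Prop :=
  k + 1 ≤ B.ncard ∧
    ∀ Y : Set V, Y ⊆ B → Y.ncard ≤ k - 1 → (G.induce (B \ Y)).Connected

/-- A `k`-block: a maximal induced `k`-connected subgraph. -/
def IsKBlock (G : SimpleGraph V) (k : ℕ) (B : Set V) : Prop :=
  KConnSet G k B ∧ ∀ B' : Set V, B ⊆ B' → KConnSet G k B' → B' = B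

namespace Stmt13

/-- Vertices: separators `x j`, arm cliques `t i k`, extra vertices `z i j`. -/
inductive Vtx (s : ℕ) : Type
  | x (j : Fin s) : Vtx s
  | t (i : Fin (s + 1)) (k : Fin s) : Vtx s
  | z (i : Fin (s + 1)) (j : Fin s) : Vtx s

def VtxEquiv (s : ℕ) :
    Vtx s ≃ (Fin s ⊕ ((Fin (s + 1) × Fin s) ⊕ (Fin (s + 1) × Fin s))) where
  toFun
    | .x j => .inl j
    | .t i k => .inr (.inl (i, k))
    | .z i j => .inr (.inr (i, j))
  invFun
    | .inl j => .x j
    | .inr (.inl (i, k)) => .t i k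
    | .inr (.inr (i, j)) => .z i j
  left_inv := by rintro (_ | _ | _) <;> rfl
  right_inv := by rintro (_ | _ | _) <;> rfl

instance (s : ℕ) : Fintype (Vtx s) := Fintype.ofEquiv _ (VtxEquiv s).symm

def adj {s : ℕ} : Vtx s → Vtx s → Prop
  | .x _, .x _ => False
  | .x _, .t _ _ => True
  | .x j, .z _ j' => j = j'
  | .t _ _, .x _ => True
  | .t i k, .t i' k' => i = i' ∧ k ≠ k'
  | .t i _, .z i' _ => i = i'
  | .z _ j, .x j' => j = j'
  | .z i _, .t i' _ => i = i'
  | .z _ _, .z _ _ => False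

def gr {W : Type*} {s : ℕ} (f : W ≃ Vtx s) : SimpleGraph W where
  Adj a b := adj (f a) (f b)
  symm := ⟨by
    intro a b h
    revert h
    cases f a <;> cases f b <;> simp [adj] <;> grind⟩
  loopless := ⟨by
    intro a h
    revert h
    cases f a <;> simp [adj]⟩

/-- Membership in the block. -/
def blk {s : ℕ} (i : Fin (s + 1)) (j : Fin s) : Vtx s → Prop
  | .x j' => j' = j
  | .t i' _ => i' = i
  | .z i' j' => i' = i ∧ j' = j

theorem closed_of_connected {W : Type*} {G : SimpleGraph W} {S : Set W}
    (h : (G.induce S).Connected) (P : W → Prop) {a b : W} (ha : a ∈ S) (hb : b ∈ S)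
    (hP : P a) (hcl : ∀ u ∈ S, ∀ v ∈ S, G.Adj u v → P u → P v) : P b := by
  obtain ⟨w⟩ := h.preconnected ⟨a, ha⟩ ⟨b, hb⟩
  have key : ∀ (u v : S), (G.induce S).Walk u v → P u → P v := by
    intro u v w
    induction w with
    | nil => exact id
    | cons hadj _ ih =>
      intro hu
      exact ih (hcl _ (Subtype.property _) _ (Subtype.property _) hadj hu)
  exact key _ _ w hP

theorem le_ncard {W : Type*} [Finite W] {n : ℕ} {ι : Type*} [Fintype ι] (g : ι → W)
    (hg : Function.Injective g) (hn : n ≤ Fintype.card ι) {S : Set W} (h : ∀ i, g i ∈ S) :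
    n ≤ S.ncard := by
  have h1 : (Set.range g).ncard = Fintype.card ι := by
    rw [← Set.image_univ, Set.ncard_image_of_injective _ hg, Set.ncard_univ,
      Nat.card_eq_fintype_card]
  have h2 : (Set.range g).ncard ≤ S.ncard :=
    Set.ncard_le_ncard (by rintro _ ⟨i, rfl⟩; exact h i) (Set.toFinite _)
  omega

theorem ncard_range {W : Type*} {ι : Type*} [Fintype ι] (g : ι → W)
    (hg : Function.Injective g) : (Set.range g).ncard = Fintype.card ι := by
  rw [← Set.image_univ, Set.ncard_image_of_injective _ hg, Set.ncard_univ,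
      Nat.card_eq_fintype_card]

section
variable {W : Type*} [Finite W] {s : ℕ} (f : W ≃ Vtx s)

theorem conn (hs : 1 ≤ s) : (gr f).Connected := by
  have hx : ∀ i k j, (gr f).Adj (f.symm (.t i k)) (f.symm (.x j)) := by
    intro i k j; simp [gr, adj]
  have hz : ∀ i j, (gr f).Adj (f.symm (.z i j)) (f.symm (.x j)) := by
    intro i j; simp [gr, adj]
  let x0 := f.symm (.x ⟨0, hs⟩)
  have hX : ∀ j, (gr f).Reachable (f.symm (.x j)) x0 := fun j =>
    ((hx 0 ⟨0, hs⟩ j).symm.reachable).trans (hx 0 ⟨0, hs⟩ ⟨0, hs⟩).reachable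
  have hall : ∀ w, (gr f).Reachable w x0 := by
    intro w
    obtain ⟨v, rfl⟩ := f.symm.surjective w
    cases v with
    | x j => exact hX j
    | t i k => exact (hx i k _).reachable
    | z i j => exact (hz i j).reachable.trans (hX j)
  have : Nonempty W := ⟨x0⟩
  exact ⟨fun a b => (hall a).trans (hall b).symm⟩

theorem good (hs : 1 ≤ s) : BootstrapGood (gr f) (s + 1) := by
  refine ⟨Set.range fun i : Fin (s + 1) => f.symm (.t i ⟨0, hs⟩), ?_, 3, ?_⟩
  · rw [ncard_range]
    · simp
    · intro a b h; simpa using h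
  · set A := Set.range fun i : Fin (s + 1) => f.symm (.t i ⟨0, hs⟩) with hA
    have hmono : ∀ n, percIter (gr f) (s + 1) A n ⊆ percIter (gr f) (s + 1) A (n + 1) :=
      fun n => Set.subset_union_left
    have hA0 : ∀ i, f.symm (.t i ⟨0, hs⟩) ∈ percIter (gr f) (s + 1) A 0 := fun i => ⟨i, rfl⟩
    have hX1 : ∀ j, f.symm (.x j) ∈ percIter (gr f) (s + 1) A 1 := by
      intro j
      refine Or.inr (le_ncard (fun i : Fin (s + 1) => f.symm (.t i ⟨0, hs⟩)) ?_ (by simp) ?_)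
      · intro a b h; simpa using h
      · intro i; exact ⟨by simp [gr, adj], hA0 i⟩
    have hT2 : ∀ i k, f.symm (.t i k) ∈ percIter (gr f) (s + 1) A 2 := by
      intro i k
      by_cases hk : k = ⟨0, hs⟩
      · subst hk; exact hmono 1 (hmono 0 (hA0 i))
      refine Or.inr (le_ncard (fun o : Option (Fin s) =>
        f.symm (o.elim (.t i ⟨0, hs⟩) .x)) ?_ (by simp) ?_)
      · intro a b h
        have := f.symm.injective h
        cases a <;> cases b <;> simp_all
      · rintro (_ | j)
        · exact ⟨by simp [gr, adj, hk], hmono 0 (hA0 i)⟩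
        · exact ⟨by simp [gr, adj], hX1 j⟩
    have hZ3 : ∀ i j, f.symm (.z i j) ∈ percIter (gr f) (s + 1) A 3 := by
      intro i j
      refine Or.inr (le_ncard (fun o : Option (Fin s) =>
        f.symm (o.elim (.x j) (.t i))) ?_ (by simp) ?_)
      · intro a b h
        have := f.symm.injective h
        cases a <;> cases b <;> simp_all
      · rintro (_ | k)
        · exact ⟨by simp [gr, adj], hmono 1 (hX1 j)⟩
        · exact ⟨by simp [gr, adj], hT2 i k⟩
    ext w
    simp only [Set.mem_univ, iff_true]
    obtain ⟨v, rfl⟩ := f.symm.surjective w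
    cases v with
    | x j => exact hmono 2 (hmono 1 (hX1 j))
    | t i k => exact hmono 2 (hT2 i k)
    | z i j => exact hZ3 i j

/-- Membership in arm `i` (or the separator). -/
def arm {s : ℕ} (i : Fin (s + 1)) : Vtx s → Prop
  | .x _ => False
  | .t i' _ => i' = i
  | .z i' _ => i' = i

theorem arm_closed (i : Fin (s + 1)) (u v : W) (hv : v ∉ Set.range fun j => f.symm (.x j))
    (h : (gr f).Adj u v) (hu : arm i (f u)) : arm i (f v) := by
  obtain ⟨u, rfl⟩ := f.symm.surjective u
  obtain ⟨v, rfl⟩ := f.symm.surjective v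
  cases u <;> cases v <;> simp_all [gr, adj, arm] 

theorem blk_closed (i : Fin (s + 1)) (j : Fin s) (u v : W)
    (hu' : u ∉ Set.range fun k => f.symm (.t i k))
    (hv : v ∉ Set.range fun k => f.symm (.t i k))
    (hv' : ∃ j, f v = .x j ∨ arm i (f v))
    (h : (gr f).Adj u v) (hu : blk i j (f u)) : blk i j (f v) := by
  obtain ⟨u, rfl⟩ := f.symm.surjective u
  obtain ⟨v, rfl⟩ := f.symm.surjective v
  cases u <;> cases v <;> simp_all [gr, adj, arm, blk]

theorem cut (hs : 1 ≤ s) : ∃ X : Set W, X.ncard < s + 1 ∧ IsCutSet (gr f) X := by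
  refine ⟨Set.range fun j => f.symm (.x j), ?_, ?_⟩
  · rw [ncard_range]
    · simp
    · intro a b h; simpa using h
  · intro hc
    have := closed_of_connected hc (fun w => arm 0 (f w))
      (a := f.symm (.t 0 ⟨0, hs⟩)) (b := f.symm (.t (Fin.last s) ⟨0, hs⟩))
      (by simp) (by simp) (by simp [arm])
      (fun u _ v hv h hu => arm_closed f 0 u v hv h hu)
    simp [arm, Fin.ext_iff] at this
    omega

theorem kconn (i : Fin (s + 1)) (j : Fin s) :
    KConnSet (gr f) (s + 1) {w | blk i j (f w)} := by
  have hcard : s + 1 + 1 ≤ ({w | blk i j (f w)} : Set W).ncard := by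
    refine le_ncard (fun o : Option (Option (Fin s)) =>
        f.symm (o.elim (.x j) fun o => o.elim (.z i j) (.t i))) ?_ (by simp) ?_
    · intro a b h
      have := f.symm.injective h
      rcases a with _ | _ | a <;> rcases b with _ | _ | b <;> simp_all
    · rintro (_ | _ | k) <;> simp [blk]
  refine ⟨hcard, ?_⟩
  intro Y hY hYc
  have hne : ({w | blk i j (f w)} \ Y).Nonempty := by
    rw [Set.nonempty_iff_ne_empty]
    intro h
    have := Set.ncard_le_ncard (Set.sdiff_eq_empty.1 h) (Set.toFinite _)
    omega
  have : Nonempty ↑({w | blk i j (f w)} \ Y) := hne.to_subtype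
  refine ⟨?_⟩
  rintro ⟨a, ha, _⟩ ⟨b, hb, _⟩
  by_cases hab : a = b
  · subst hab; exact Reachable.refl _
  · refine Adj.reachable ?_
    change adj (f a) (f b)
    obtain ⟨a, rfl⟩ := f.symm.surjective a
    obtain ⟨b, rfl⟩ := f.symm.surjective b
    cases a <;> cases b <;> simp_all [adj, blk]

theorem block (hs : 1 ≤ s) (i : Fin (s + 1)) (j : Fin s) :
    IsKBlock (gr f) (s + 1) {w | blk i j (f w)} := by
  refine ⟨kconn f i j, ?_⟩
  intro B hB hK
  have hT : ∀ k, f.symm (.t i k) ∈ B := fun k => hB (by simp [blk])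
  have hZ : f.symm (.z i j) ∈ B := hB (by simp [blk])
  have hXc : (Set.range fun j => f.symm (.x j)).ncard = s := by
    rw [ncard_range]
    · simp
    · intro a b h; simpa using h
  have hTc : (Set.range fun k => f.symm (.t i k)).ncard = s := by
    rw [ncard_range]
    · simp
    · intro a b h; simpa using h
  have harm : ∀ w ∈ B, w ∉ (Set.range fun j => f.symm (.x j)) → arm i (f w) := by
    intro w hw hwX
    have hc := hK.2 (B ∩ Set.range fun j => f.symm (.x j)) Set.inter_subset_left (by
      have := Set.ncard_le_ncard (Set.inter_subset_right (s := B)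
        (t := Set.range fun j => f.symm (.x j))) (Set.toFinite _)
      omega)
    refine closed_of_connected hc (fun w => arm i (f w)) (a := f.symm (.z i j)) (b := w)
      ⟨hZ, by simp⟩ ⟨hw, fun h => hwX h.2⟩ (by simp [arm]) ?_
    intro u _ v hv h hu
    exact arm_closed f i u v (fun h => hv.2 ⟨hv.1, h⟩) h hu
  have harm' : ∀ w ∈ B, ∃ j, f w = .x j ∨ arm i (f w) := by
    intro w hw
    by_cases h : w ∈ (Set.range fun j => f.symm (.x j))
    · obtain ⟨j, rfl⟩ := h
      exact ⟨j, Or.inl (by simp)⟩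
    · exact ⟨j, Or.inr (harm w hw h)⟩
  refine Set.Subset.antisymm ?_ hB
  intro w hw
  by_cases hwT : w ∈ Set.range fun k => f.symm (.t i k)
  · obtain ⟨k, rfl⟩ := hwT
    simp [blk]
  have hc := hK.2 (Set.range fun k => f.symm (.t i k))
    (by rintro _ ⟨k, rfl⟩; exact hT k) (by omega)
  refine closed_of_connected hc (fun w => blk i j (f w)) (a := f.symm (.z i j)) (b := w)
    ⟨hZ, by simp⟩ ⟨hw, hwT⟩ (by simp [blk]) ?_
  intro u hu0 v hv h hu
  exact blk_closed f i j u v hu0.2 hv.2 (harm' v hv.1) h hu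

theorem count (hs : 1 ≤ s) :
    (s + 1) * s ≤ {B : Set W | IsKBlock (gr f) (s + 1) B}.ncard := by
  refine le_ncard (fun p : Fin (s + 1) × Fin s => {w | blk p.1 p.2 (f w)}) ?_ (by simp) ?_
  · rintro ⟨i, j⟩ ⟨i', j'⟩ h
    have : f.symm (.z i j) ∈ {w | blk i' j' (f w)} := by
      simp only at h
      rw [← h]; simp [blk]
    simpa [blk] using this
  · rintro ⟨i, j⟩
    exact block f hs i j

theorem card_le {W : Type*} [Fintype W] {s : ℕ} (f : W ≃ Vtx s) (hs : 1 ≤ s) : s + 1 + 1 ≤ Fintype.card W := by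
  have := (kconn f 0 ⟨0, hs⟩).1
  have h2 := Set.ncard_le_ncard (Set.subset_univ {w | blk (0 : Fin (s + 1)) ⟨0, hs⟩ (f w)})
    (Set.toFinite _)
  rw [Set.ncard_univ, Nat.card_eq_fintype_card] at h2
  omega

end

end Stmt13

/-- For every `r ≥ 2` there is a connected `r`-bootstrap good graph with at least
`r + 1` vertices, a cut set of size less than `r`, and at least `r(r-1)` distinct
`r`-blocks. -/
theorem stmt_13 (r : ℕ) (hr : 2 ≤ r) :
    ∃ (n : ℕ) (G : SimpleGraph (Fin n)),
      G.Connected ∧ r + 1 ≤ n ∧ BootstrapGood G r ∧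
      (∃ X : Set (Fin n), X.ncard < r ∧ IsCutSet G X) ∧
      r * (r - 1) ≤ {B : Set (Fin n) | IsKBlock G r B}.ncard := by
  obtain ⟨s, rfl⟩ : ∃ s, r = s + 1 := ⟨r - 1, by omega⟩
  have hs : 1 ≤ s := by omega
  let f := (Fintype.equivFin (Stmt13.Vtx s)).symm
  refine ⟨_, Stmt13.gr f, Stmt13.conn f hs, ?_, Stmt13.good f hs, Stmt13.cut f hs, ?_⟩
  · simpa using Stmt13.card_le f hs
  · simpa using Stmt13.count f hs
end

section
/- For every r ≥ 2, every d ≥ 2, and every s ≥ 1, there exists a finite connected simple graph G of diameter d and a set A₀ ⊆ V(G) which percolates under r-bootstrap percolation in exactly d + s rounds (counting the initial round as round 1). In particular, the number of rounds to percolation is not bounded above by any function of the diameter and the threshold. -/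
open SimpleGraph

variable {V : Type*}

/-- The path on `Fin n` together with all edges upward from the vertices in `[c, c+r-2]`. -/
def pGraph (n c r : ℕ) : SimpleGraph (Fin n) where
  Adj u v := (v.val = u.val + 1 ∨ (u.val < v.val ∧ c ≤ u.val ∧ u.val + 1 < c + r)) ∨
    (u.val = v.val + 1 ∨ (v.val < u.val ∧ c ≤ v.val ∧ v.val + 1 < c + r))
  symm := ⟨fun u v h => by tauto⟩
  loopless := ⟨fun u h => by omega⟩

theorem pGraph_adj {n c r : ℕ} {u v : Fin n} : (pGraph n c r).Adj u v ↔
    (v.val = u.val + 1 ∨ (u.val < v.val ∧ c ≤ u.val ∧ u.val + 1 < c + r)) ∨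
    (u.val = v.val + 1 ∨ (v.val < u.val ∧ c ≤ v.val ∧ v.val + 1 < c + r)) := Iff.rfl

theorem pGraph_walk (n c r k : ℕ) : ∀ (u v : Fin n), v.val = u.val + k →
    ∃ p : (pGraph n c r).Walk u v, p.length = k := by
  induction k with
  | zero =>
    intro u v h
    obtain rfl : u = v := Fin.ext (by omega)
    exact ⟨Walk.nil, rfl⟩
  | succ k ih =>
    intro u v h
    have hlt : u.val + 1 < n := by omega
    obtain ⟨p, hp⟩ := ih ⟨u.val + 1, hlt⟩ v (by simp only; omega)
    exact ⟨Walk.cons (pGraph_adj.2 (Or.inl (Or.inl rfl))) p, by simp [hp]⟩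

theorem pGraph_connected (n c r : ℕ) (hn : 0 < n) : (pGraph n c r).Connected := by
  haveI : Nonempty (Fin n) := ⟨⟨0, hn⟩⟩
  refine ⟨fun u v => ?_⟩
  rcases le_total u.val v.val with h | h
  · obtain ⟨p, -⟩ := pGraph_walk n c r (v.val - u.val) u v (by omega)
    exact ⟨p⟩
  · obtain ⟨p, -⟩ := pGraph_walk n c r (u.val - v.val) v u (by omega)
    exact ⟨p.reverse⟩

theorem pGraph_lip (n c r : ℕ) {u v : Fin n} (p : (pGraph n c r).Walk u v) :
    min v.val (c + 1) ≤ min u.val (c + 1) + p.length := by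
  induction p with
  | nil => simp
  | cons h p ih =>
    rw [pGraph_adj] at h
    rw [Walk.length_cons]
    omega

theorem pGraph_dist_le (n c r : ℕ) (hc : 1 ≤ c) (hr : 2 ≤ r) (hn : c < n) (u v : Fin n)
    (huv : u.val ≤ v.val) : (pGraph n c r).dist u v ≤ c + 1 := by
  have hcon := pGraph_connected n c r (by omega)
  have key : ∀ w : Fin n, c ≤ w.val → (pGraph n c r).dist ⟨c, hn⟩ w ≤ 1 := by
    intro w hw
    rcases hw.eq_or_lt with h | h
    · have : (⟨c, hn⟩ : Fin n) = w := Fin.ext h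
      rw [this, SimpleGraph.dist_self]; omega
    · have : (pGraph n c r).Adj ⟨c, hn⟩ w :=
        pGraph_adj.2 (Or.inl (Or.inr ⟨h, le_rfl, by simp only; omega⟩))
      exact (SimpleGraph.dist_eq_one_iff_adj.2 this).le
  have path : ∀ a b : Fin n, a.val ≤ b.val → (pGraph n c r).dist a b ≤ b.val - a.val := by
    intro a b h
    obtain ⟨p, hp⟩ := pGraph_walk n c r (b.val - a.val) a b (by omega)
    exact hp ▸ SimpleGraph.dist_le p
  by_cases hv : v.val ≤ c
  · have := path u v huv
    omega
  · have h1 := key v (by omega)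
    have h2 := hcon.dist_triangle (u := u) (v := ⟨c, hn⟩) (w := v)
    by_cases hu : u.val ≤ c
    · have := path u ⟨c, hn⟩ hu
      simp only at this
      omega
    · have := key u (by omega)
      rw [SimpleGraph.dist_comm] at this
      omega

theorem pGraph_diam (n c r : ℕ) (hc : 1 ≤ c) (hr : 2 ≤ r) (hn : c + 1 < n) :
    (pGraph n c r).diam = c + 1 := by
  have hcon := pGraph_connected n c r (by omega)
  haveI : Nonempty (Fin n) := ⟨⟨0, by omega⟩⟩
  apply le_antisymm
  · obtain ⟨u, v, h⟩ := (pGraph n c r).exists_dist_eq_diam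
    rw [← h]
    rcases le_total u.val v.val with h | h
    · exact pGraph_dist_le n c r hc hr (by omega) u v h
    · rw [SimpleGraph.dist_comm]
      exact pGraph_dist_le n c r hc hr (by omega) v u h
  · have h1 := SimpleGraph.dist_le_diam (SimpleGraph.connected_iff_ediam_ne_top.1 hcon)
      (u := ⟨0, by omega⟩) (v := ⟨c + 1, hn⟩)
    obtain ⟨p, hp⟩ := hcon.exists_walk_length_eq_dist ⟨0, by omega⟩ ⟨c + 1, hn⟩
    have := pGraph_lip n c r p
    simp only at this
    omega

theorem pGraph_iter (n c r : ℕ) (hr : 2 ≤ r) (t : ℕ) :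
    percIter (pGraph n c r) r {v | v.val < c + r} t = {v | v.val < c + r + t} := by
  induction t with
  | zero => rfl
  | succ t ih =>
    rw [percIter, ih]
    ext v
    simp only [percStep, Set.mem_union, Set.mem_setOf_eq]
    rw [← Set.ncard_image_of_injective _ Fin.val_injective]
    constructor
    · rintro (h | h)
      · omega
      · by_contra hv
        have hsub : Fin.val '' ((pGraph n c r).neighborSet v ∩ {v | v.val < c + r + t}) ⊆
            (Finset.Ico c (c + r - 1) : Finset ℕ) := by
          rintro _ ⟨w, ⟨hw, hw2⟩, rfl⟩
          rw [SimpleGraph.mem_neighborSet, pGraph_adj] at hw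
          simp only [Set.mem_setOf_eq] at hw2
          simp only [Finset.coe_Ico, Set.mem_Ico]
          omega
        have := Set.ncard_le_ncard hsub (Finset.finite_toSet _)
        rw [Set.ncard_coe_finset, Nat.card_Ico] at this
        omega
    · intro h
      by_cases hv : v.val < c + r + t
      · exact Or.inl hv
      · right
        have hsub : ((insert (c + r + t - 1) (Finset.Ico c (c + r - 1)) : Finset ℕ) : Set ℕ) ⊆
            Fin.val '' ((pGraph n c r).neighborSet v ∩ {v | v.val < c + r + t}) := by
          intro x hx
          simp only [Finset.coe_insert, Finset.coe_Ico, Set.mem_insert_iff, Set.mem_Ico] at hx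
          have hvn := v.isLt
          refine ⟨⟨x, by omega⟩, ⟨?_, ?_⟩, rfl⟩
          · rw [SimpleGraph.mem_neighborSet, pGraph_adj]
            simp only
            omega
          · simp only [Set.mem_setOf_eq]
            omega
        have := Set.ncard_le_ncard hsub (Set.toFinite _)
        rw [Set.ncard_coe_finset, Finset.card_insert_of_notMem, Nat.card_Ico] at this
        · omega
        · simp only [Finset.mem_Ico]
          omega

/-- For every `r ≥ 2`, `d ≥ 2`, `s ≥ 1` there is a connected graph of diameter `d` and
a set percolating under `r`-bootstrap percolation in exactly `d + s` rounds; hence the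
number of rounds is not bounded above by any function of diameter and threshold. -/
theorem stmt_17 (r d s : ℕ) (hr : 2 ≤ r) (hd : 2 ≤ d) (hs : 1 ≤ s) :
    ∃ (n : ℕ) (G : SimpleGraph (Fin n)) (A₀ : Set (Fin n)),
      G.Connected ∧ G.diam = d ∧ PercolatesIn G r A₀ (d + s) := by
  refine ⟨(d - 1) + r + (d + s - 1), pGraph _ (d - 1) r, {v | v.val < (d - 1) + r},
    pGraph_connected _ _ _ (by omega), ?_, by omega, ?_, ?_⟩
  · rw [pGraph_diam _ _ _ (by omega) hr (by omega)]
    omega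
  · rw [pGraph_iter _ _ _ hr]
    ext v
    simpa using v.isLt
  · intro j hj h
    rw [pGraph_iter _ _ _ hr] at h
    have : (⟨(d - 1) + r + j, by omega⟩ : Fin ((d - 1) + r + (d + s - 1))) ∈
        (Set.univ : Set (Fin ((d - 1) + r + (d + s - 1)))) := Set.mem_univ _
    rw [← h] at this
    simp at this
end

section
/- For every r ≥ 2 and every D ≥ 2, there exists a finite connected simple graph G (a caterpillar tree) whose longest path has length exactly D, together with a set A₀ ⊆ V(G) which percolates under r-bootstrap percolation in exactly D rounds (counting the initial round as round 1); that is, for every threshold r ≥ 2 and every value of the detour diameter, the bound of diam_D(G) rounds is attained. -/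
open SimpleGraph

variable {V : Type*}

/-- Parent function of the caterpillar: spine `0..d`, leaves `> d`. -/
def catPar (d K v : ℕ) : ℕ := if v ≤ d then v - 1 else d - (v - (d + 1)) / K

def catG (d K : ℕ) : SimpleGraph (Fin (d + 1 + d * K)) where
  Adj u v := (u.val < v.val ∧ u.val = catPar d K v) ∨ (v.val < u.val ∧ v.val = catPar d K u)
  symm := ⟨fun _ _ h => h.symm⟩
  loopless := ⟨fun _ h => by omega⟩

lemma catG_adj {d K : ℕ} {u v : Fin (d + 1 + d * K)} : (catG d K).Adj u v ↔
    (u.val < v.val ∧ u.val = catPar d K v) ∨ (v.val < u.val ∧ v.val = catPar d K u) := Iff.rfl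

lemma catPar_spine {d K v : ℕ} (h : v ≤ d) : catPar d K v = v - 1 := by simp [catPar, h]

lemma catPar_le {d K v : ℕ} (h : d < v) : catPar d K v ≤ d := by
  simp [catPar, Nat.not_le.2 h]

lemma catPar_pos {d K v : ℕ} (h : d < v) (hv : v < d + 1 + d * K) : 1 ≤ catPar d K v := by
  have : (v - (d + 1)) / K < d := by
    apply Nat.div_lt_of_lt_mul
    rw [mul_comm K d]; omega
  simp only [catPar, Nat.not_le.2 h, if_false]
  omega

lemma catPar_lt {d K v : ℕ} (h : 0 < v) : catPar d K v < v := by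
  by_cases hv : v ≤ d
  · rw [catPar_spine hv]; omega
  · have := catPar_le (K := K) (Nat.not_le.1 hv); omega

lemma catPar_succ {d K v : ℕ} (h : v ≤ d) : catPar d K (v + 1) = v := by
  by_cases hv : v + 1 ≤ d
  · rw [catPar_spine hv]; omega
  · have : v = d := by omega
    subst this
    simp [catPar]

lemma catPar_leaf {d K v i : ℕ} (hK : 1 ≤ K) (h : d < v) (hi : 1 ≤ i) (hid : i ≤ d) :
    catPar d K v = i ↔ d + 1 + (d - i) * K ≤ v ∧ v < d + 1 + (d - i) * K + K := by
  have e : catPar d K v = i ↔ (v - (d + 1)) / K = d - i := by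
    simp only [catPar, Nat.not_le.2 h, if_false]; omega
  have h1 : d - i ≤ (v - (d + 1)) / K ↔ (d - i) * K ≤ v - (d + 1) := Nat.le_div_iff_mul_le hK
  have h2 : (v - (d + 1)) / K < d - i + 1 ↔ v - (d + 1) < (d - i + 1) * K :=
    Nat.div_lt_iff_lt_mul hK
  rw [add_mul, one_mul] at h2
  rw [e]; omega

lemma catG_connected (d K : ℕ) : (catG d K).Connected := by
  have h0 : 0 < d + 1 + d * K := by omega
  have key : ∀ m : ℕ, ∀ hm : m < d + 1 + d * K,
      (catG d K).Reachable ⟨0, h0⟩ ⟨m, hm⟩ := by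
    intro m
    induction m using Nat.strong_induction_on with
    | _ m ih =>
      intro hm
      rcases Nat.eq_zero_or_pos m with rfl | hp
      · exact Reachable.refl _
      · have hl := catPar_lt (d := d) (K := K) hp
        refine (ih _ hl (hl.trans hm)).trans (Adj.reachable ?_)
        rw [catG_adj]; left; exact ⟨hl, rfl⟩
  have : Nonempty (Fin (d + 1 + d * K)) := ⟨⟨0, h0⟩⟩
  exact ⟨fun u v => (key u u.2).symm.trans (key v v.2)⟩

lemma catG_tree (d K : ℕ) : (catG d K).IsTree := by
  have h0 : 0 < d + 1 + d * K := by omega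
  rw [isTree_iff_connected_and_card]
  refine ⟨catG_connected d K, le_antisymm ?_ ?_⟩
  · let f : Fin (d + 1 + d * K) → Sym2 (Fin (d + 1 + d * K)) := fun v =>
      if h : 0 < v.val then s(v, ⟨catPar d K v, (catPar_lt h).trans v.2⟩) else s(v, v)
    have hsub : (catG d K).edgeSet ⊆ f '' {⟨0, h0⟩}ᶜ := by
      intro e
      induction e using Sym2.ind with
      | _ u v =>
        intro he
        rw [mem_edgeSet, catG_adj] at he
        rcases he with ⟨h1, h2⟩ | ⟨h1, h2⟩
        · refine ⟨v, ?_, ?_⟩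
          · intro h; simp only [Set.mem_singleton_iff, Fin.ext_iff] at h; omega
          · have : 0 < v.val := by omega
            simp only [f, this, dif_pos]
            exact Sym2.eq_iff.2 (Or.inr ⟨rfl, Fin.ext h2.symm⟩)
        · refine ⟨u, ?_, ?_⟩
          · intro h; simp only [Set.mem_singleton_iff, Fin.ext_iff] at h; omega
          · have : 0 < u.val := by omega
            simp only [f, this, dif_pos]
            exact Sym2.eq_iff.2 (Or.inl ⟨rfl, Fin.ext h2.symm⟩)
    have h1 := Set.ncard_le_ncard hsub (Set.toFinite _)
    have h2 := Set.ncard_image_le (f := f) (Set.toFinite ({⟨0, h0⟩}ᶜ : Set _))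
    rw [Set.ncard_compl, Set.ncard_singleton] at h2
    rw [Nat.card_coe_set_eq]
    have : Nat.card (Fin (d + 1 + d * K)) = d + 1 + d * K := by simp
    omega
  · exact (catG_connected d K).card_vert_le_card_edgeSet_add_one

lemma catG_path_exists (d K : ℕ) (hd : 1 ≤ d) (hK : 1 ≤ K) :
    ∃ (u v : Fin (d + 1 + d * K)) (p : (catG d K).Walk u v), p.IsPath ∧ p.length = d + 1 := by
  have hn : d + 1 < d + 1 + d * K := by nlinarith
  have key : ∀ m : ℕ, ∀ hm : m ≤ d + 1, ∃ p : (catG d K).Walk ⟨0, by omega⟩ ⟨m, by omega⟩,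
      p.IsPath ∧ p.length = m ∧ ∀ x ∈ p.support, x.val ≤ m := by
    intro m
    induction m with
    | zero => intro _; exact ⟨Walk.nil, by simp, by simp, by simp⟩
    | succ m ih =>
      intro hm
      obtain ⟨p, hp, hl, hs⟩ := ih (by omega)
      have hadj : (catG d K).Adj ⟨m, by omega⟩ ⟨m + 1, by omega⟩ := by
        rw [catG_adj]; left; exact ⟨by simp, (catPar_succ (show m ≤ d by omega)).symm⟩
      refine ⟨p.concat hadj, hp.concat ?_ hadj, by rw [Walk.length_concat, hl], ?_⟩
      · intro h; have := hs _ h; simp at this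
      · intro x hx
        simp only [Walk.support_concat, List.mem_append,
          List.mem_singleton] at hx
        rcases hx with hx | rfl
        · have := hs _ hx; omega
        · simp
  obtain ⟨p, hp, hl, -⟩ := key (d + 1) le_rfl
  exact ⟨_, _, p, hp, hl⟩

lemma catG_inner {d K : ℕ} {u v w : Fin (d + 1 + d * K)} (h1 : (catG d K).Adj v u)
    (h2 : (catG d K).Adj v w) (hne : u ≠ w) : 1 ≤ v.val ∧ v.val ≤ d := by
  have hne' : u.val ≠ w.val := fun h => hne (Fin.ext h)
  rw [catG_adj] at h1 h2
  have A : ∀ x : Fin (d + 1 + d * K), x.val ≤ d ∧ catPar d K x = x.val - 1 ∨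
      d < x.val ∧ catPar d K x ≤ d ∧ 1 ≤ catPar d K x := by
    intro x
    by_cases hx : x.val ≤ d
    · exact Or.inl ⟨hx, catPar_spine hx⟩
    · exact Or.inr ⟨by omega, catPar_le (by omega), catPar_pos (by omega) x.2⟩
  have := A u
  have := A v
  have := A w
  omega

lemma catG_path_le {d K : ℕ} {u v : Fin (d + 1 + d * K)} (p : (catG d K).Walk u v)
    (hp : p.IsPath) : p.length ≤ d + 1 := by
  have hinj := hp.getVert_injOn
  have hmaps : ∀ i ∈ Finset.Ico 1 p.length, (p.getVert i).val ∈ Finset.Icc 1 d := by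
    intro i hi
    rw [Finset.mem_Ico] at hi
    rw [Finset.mem_Icc]
    have a1 := p.adj_getVert_succ (i := i - 1) (by omega)
    have a2 := p.adj_getVert_succ (i := i) (by omega)
    rw [Nat.sub_add_cancel hi.1] at a1
    refine catG_inner a1.symm a2 ?_
    intro h
    have := hinj (show i - 1 ≤ p.length by omega) (show i + 1 ≤ p.length by omega) h
    omega
  have := Finset.card_le_card_of_injOn (fun i => (p.getVert i).val) hmaps (by
    intro i hi j hj hij
    simp only [Finset.coe_Ico, Set.mem_Ico] at hi hj
    exact hinj (show i ≤ p.length by omega) (show j ≤ p.length by omega) (Fin.ext hij))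
  simp at this
  omega

lemma catG_iter (d K : ℕ) (hK : 1 ≤ K) (t : ℕ) :
    percIter (catG d K) (K + 1) {v | d < v.val ∨ v.val = 0} t = {v | d < v.val ∨ v.val ≤ t} := by
  induction t with
  | zero => simp [percIter]
  | succ t ih =>
    rw [percIter, ih, percStep]
    ext v
    simp only [Set.mem_union, Set.mem_ofPred_eq]
    by_cases hA : d < v.val ∨ v.val ≤ t
    · simp only [hA, true_or, true_iff]; omega
    simp only [hA, false_or]
    set S := (catG d K).neighborSet v ∩ {v | d < v.val ∨ v.val ≤ t} with hS
    have hc : S.ncard = (Fin.val '' S).ncard := (Set.ncard_image_of_injective S Fin.val_injective).symm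
    have hv1 : 1 ≤ v.val := by omega
    have hvd : v.val ≤ d := by omega
    have hleaf := fun x (hx : d < x) => catPar_leaf (v := x) hK hx hv1 hvd
    have hbd : (d - v.val) * K + K ≤ d * K := by
      have : (d - v.val + 1) * K ≤ d * K := Nat.mul_le_mul_right _ (by omega)
      rwa [add_mul, one_mul] at this
    set a := d + 1 + (d - v.val) * K with ha
    constructor
    · intro h
      by_contra hcon
      have hsub : Fin.val '' S ⊆ (Finset.Ico a (a + K) : Finset ℕ) := by
        rintro _ ⟨w, ⟨hw1, hw2⟩, rfl⟩
        rw [mem_neighborSet, catG_adj, catPar_spine hvd] at hw1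
        simp only [Set.mem_ofPred_eq] at hw2
        have hdw : d < w.val := by
          by_contra hh
          rw [catPar_spine (by omega : w.val ≤ d)] at hw1
          omega
        have := hleaf _ hdw
        rw [Finset.coe_Ico, Set.mem_Ico]
        omega
      have := Set.ncard_le_ncard hsub (Set.toFinite _)
      rw [Set.ncard_coe_finset, Nat.card_Ico] at this
      omega
    · intro h
      have hvt : v.val = t + 1 := by omega
      have hsub : ((insert t (Finset.Ico a (a + K)) : Finset ℕ) : Set ℕ) ⊆ Fin.val '' S := by
        intro x hx
        simp only [Finset.coe_insert, Finset.coe_Ico, Set.mem_insert_iff, Set.mem_Ico] at hx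
        refine ⟨⟨x, by omega⟩, ⟨?_, ?_⟩, rfl⟩
        · rw [mem_neighborSet, catG_adj, catPar_spine hvd]
          rcases hx with rfl | hx
          · right; simp only; omega
          · left
            have := hleaf x (by omega)
            simp only; omega
        · simp only [Set.mem_ofPred_eq]; omega
      have := Set.ncard_le_ncard hsub (Set.toFinite _)
      rw [Set.ncard_coe_finset, Finset.card_insert_of_notMem, Nat.card_Ico] at this
      · omega
      · rw [Finset.mem_Ico]; omega

/-- For every `r ≥ 2` and every detour diameter `D ≥ 2` there is a connected tree (a
caterpillar) whose longest path has length exactly `D`, together with a set percolating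
under `r`-bootstrap percolation in exactly `D` rounds. -/
theorem stmt_19 (r D : ℕ) (hr : 2 ≤ r) (hD : 2 ≤ D) :
    ∃ (n : ℕ) (G : SimpleGraph (Fin n)) (A₀ : Set (Fin n)),
      G.Connected ∧ G.IsTree ∧
      sSup {ℓ : ℕ | ∃ (u v : Fin n) (p : G.Walk u v), p.IsPath ∧ p.length = ℓ} = D ∧
      PercolatesIn G r A₀ D := by
  obtain ⟨d, rfl⟩ : ∃ d, D = d + 1 := ⟨D - 1, by omega⟩
  obtain ⟨K, rfl⟩ : ∃ K, r = K + 1 := ⟨r - 1, by omega⟩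
  refine ⟨_, catG d K, {v | d < v.val ∨ v.val = 0}, catG_connected d K, catG_tree d K, ?_, ?_⟩
  · apply IsGreatest.csSup_eq
    refine ⟨catG_path_exists d K (by omega) (by omega), ?_⟩
    rintro _ ⟨u, v, p, hp, rfl⟩
    exact catG_path_le p hp
  · refine ⟨by omega, ?_, ?_⟩
    · rw [catG_iter d K (by omega)]
      ext v; simp only [Set.mem_ofPred_eq, Set.mem_univ, iff_true]; omega
    · intro j hj h
      rw [catG_iter d K (by omega)] at h
      have : (⟨d, by omega⟩ : Fin (d + 1 + d * K)) ∈ {v : Fin (d + 1 + d * K) | d < v.val ∨ v.val ≤ j} := by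
        rw [h]; trivial
      simp only [Set.mem_ofPred_eq] at this
      omega
end
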